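/- arXiv:2305.09008 — 7 statements merged into one kernel-verified Lean document; each statement's English description precedes it below -/
import Mathlib

section
/- Let G be a finite group, p a prime and S a Sylow p-subgroup of G, and let O_p(G) denote the largest normal p-subgroup of G. Suppose that: (i) for every proper subgroup H of G with O_p(G) < S ∩ H and with S ∩ H a Sylow p-subgroup of H, there exists a chain 1 = T_0 ≤ T_1 ≤ … ≤ T_k = S ∩ H of subgroups of S ∩ H, each strongly closed in S ∩ H with respect to H, with each quotient T_{i+1}/T_i cyclic; and (ii) there exists a chain 1 = U_0 ≤ U_1 ≤ … ≤ U_n = O_p(G) of subgroups, each normal in G, with each quotient U_{i+1}/U_i cyclic (i.e., O_p(G) lies in the supersolvable hypercentre of G). Then there exists a chain 1 = S_0 ≤ S_1 ≤ … ≤ S_m = S of subgroups of S, each strongly closed in S with respect to G, with each quotient S_{i+1}/S_i cyclic (i.e., F_S(G) is supersolvable). -/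
/-- `T` is strongly closed in `S` with respect to `H` (fusion taken inside the
subgroup `H`): for every `x ∈ T` and `g ∈ H` with `g⁻¹xg ∈ S` one has `g⁻¹xg ∈ T`. -/
def StronglyClosedIn {G : Type*} [Group G] (H S T : Subgroup G) : Prop :=
  T ≤ S ∧ ∀ x ∈ T, ∀ g ∈ H, g⁻¹ * x * g ∈ S → g⁻¹ * x * g ∈ T

/-- The quotient `B/A` is cyclic (generated modulo `A` by a single element of `B`). -/
def CyclicFactor {G : Type*} [Group G] (A B : Subgroup G) : Prop :=
  ∃ x ∈ B, ∀ y ∈ B, ∃ n : ℤ, y⁻¹ * x ^ n ∈ A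

/-- The fusion system `F_S(H)` is supersolvable: there is a chain
`1 = T_0 ≤ … ≤ T_k = S` of subgroups of `S`, each strongly closed in `S` with
respect to `H`, with all successive quotients cyclic. -/
def FusionSupersolvableIn {G : Type*} [Group G] (H S : Subgroup G) : Prop :=
  ∃ (m : ℕ) (c : Fin (m + 1) → Subgroup G), Monotone c ∧ c 0 = ⊥ ∧ c (Fin.last m) = S ∧
    (∀ i, StronglyClosedIn H S (c i)) ∧ ∀ i : Fin m, CyclicFactor (c i.castSucc) (c i.succ)

/-- `P` is a Sylow `p`-subgroup of the subgroup `H`. -/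
def IsSylowIn {G : Type*} [Group G] (p : ℕ) (H P : Subgroup G) : Prop :=
  P ≤ H ∧ IsPGroup p P ∧ ∀ Q : Subgroup G, Q ≤ H → IsPGroup p Q → P ≤ Q → Q = P

open scoped commutatorElement Pointwise

theorem commutator_le_centralizer_of_isCyclic {N : Type*} [Group N] (B : Subgroup N)
    [B.Normal] [IsCyclic B] : commutator N ≤ Subgroup.centralizer (B : Set N) := by
  let φ : N →* (ZMod (Nat.card B))ˣ :=
    (IsCyclic.mulAutMulEquiv B).toMonoidHom.comp MulAut.conjNormal
  intro y hy
  have hφ : φ y = 1 := Abelianization.commutator_subset_ker φ hy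
  have hconj : (MulAut.conjNormal y : MulAut B) = 1 :=
    (IsCyclic.mulAutMulEquiv B).injective (by simpa [φ] using hφ)
  rw [Subgroup.mem_centralizer_iff]
  intro b hb
  have hb' := congrArg Subtype.val (DFunLike.congr_fun hconj ⟨b, hb⟩)
  simp only [MulAut.conjNormal_apply, MulAut.one_apply] at hb'
  exact (mul_inv_eq_iff_eq_mul.mp hb').symm

theorem CyclicFactor.commutatorElement_mem {N : Type*} [Group N] {A B : Subgroup N}
    (hA : A.Normal) (hB : B.Normal) (h : CyclicFactor A B) {y r : N} (hy : y ∈ commutator N)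
    (hr : r ∈ B) : ⁅y, r⁆ ∈ A := by
  obtain ⟨x, hx, hgen⟩ := h
  have : (B.map (QuotientGroup.mk' A)).Normal :=
    hB.map _ (QuotientGroup.mk'_surjective A)
  have hcyc : IsCyclic (B.map (QuotientGroup.mk' A)) := by
    rw [Subgroup.isCyclic_iff_exists_zpowers_eq_top]
    refine ⟨QuotientGroup.mk' A x, le_antisymm ?_ ?_⟩
    · rw [Subgroup.zpowers_le]
      exact Subgroup.mem_map_of_mem _ hx
    · rintro _ ⟨b, hb, rfl⟩
      obtain ⟨n, hn⟩ := hgen b hb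
      refine Subgroup.mem_zpowers_iff.mpr ⟨n, ?_⟩
      rw [← map_zpow]
      exact (QuotientGroup.eq.mpr hn).symm
  have hy' : QuotientGroup.mk' A y ∈ commutator (N ⧸ A) := by
    have := Subgroup.mem_map_of_mem (QuotientGroup.mk' A) hy
    rw [map_commutator_eq] at this
    exact Subgroup.commutator_mono le_top le_top this
  have hcomm := Subgroup.mem_centralizer_iff.mp
    (commutator_le_centralizer_of_isCyclic (B.map (QuotientGroup.mk' A)) hy')
    _ (Subgroup.mem_map_of_mem (QuotientGroup.mk' A) hr)
  rw [← QuotientGroup.ker_mk' A, MonoidHom.mem_ker, map_commutatorElement,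
    commutatorElement_eq_one_iff_mul_comm]
  exact hcomm.symm

theorem commute_pow_pow_of_commutatorElement_mem {N : Type*} [Group N] {K : Subgroup N} {q m : ℕ}
    {c : Fin (m + 1) → Subgroup N} (h0 : c 0 = ⊥) (hq : ∀ i, ∀ r ∈ c i, r ^ q = 1)
    (hK : ∀ i : Fin m, ∀ y ∈ K, ∀ r ∈ c i.succ, ⁅y, r⁆ ∈ c i.castSucc)
    {y : N} (hy : y ∈ K) (i : Fin (m + 1)) : ∀ r ∈ c i, Commute (y ^ q ^ (i : ℕ)) r := by
  induction i using Fin.induction with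
  | zero =>
    intro r hr
    rw [h0, Subgroup.mem_bot] at hr
    rw [hr]
    exact Commute.one_right _
  | succ i ih =>
    intro r hr
    have hz := hK i _ (K.pow_mem hy (q ^ (i : ℕ))) r hr
    have hza := ih _ hz
    rw [Fin.val_castSucc] at hza
    rw [Fin.val_succ, pow_succ, pow_mul]
    generalize y ^ q ^ (i : ℕ) = z at hz hza ⊢
    have hpow (k : ℕ) : z ^ k * r = ⁅z, r⁆ ^ k * (r * z ^ k) := by
      induction k with
      | zero => simp
      | succ k ihk =>
        calc z ^ (k + 1) * r = z * (z ^ k * r) := by rw [pow_succ', mul_assoc]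
          _ = z * ⁅z, r⁆ ^ k * (r * z ^ k) := by rw [ihk, mul_assoc]
          _ = ⁅z, r⁆ ^ k * (z * r * z ^ k) := by rw [(hza.pow_right k).eq]; group
          _ = ⁅z, r⁆ ^ (k + 1) * (r * z ^ (k + 1)) := by
            rw [pow_succ ⁅z, r⁆, pow_succ' z]
            simp only [commutatorElement_def]
            group
    have := hpow q
    rwa [hq _ _ hz, one_mul] at this

theorem Sylow.exists_mem_normalizer_mul_mem_centralizer {N : Type*} [Group N] [Finite N] {p : ℕ}
    [Fact p.Prime] (P : Sylow p N) {R : Subgroup N} (hR : IsPGroup p R) {m : ℕ}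
    {c : Fin (m + 1) → Subgroup N} (hmono : Monotone c) (h0 : c 0 = ⊥) (hlast : c (Fin.last m) = R)
    (hn : ∀ i, (c i).Normal) (hc : ∀ i : Fin m, CyclicFactor (c i.castSucc) (c i.succ)) (y : N) :
    ∃ a ∈ Subgroup.normalizer (P : Set N),
      ∃ z ∈ Subgroup.centralizer (R : Set N), a * z = y := by
  have hRn : R.Normal := hlast ▸ hn _
  set C := Subgroup.centralizer (R : Set N) with hC
  obtain ⟨s, hs⟩ := hR.exists_card_eq
  have hpow : ∀ x ∈ commutator N, x ^ (p ^ (s * m)) ∈ C := by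
    intro x hx
    rw [hC, Subgroup.mem_centralizer_iff]
    intro r hr
    have := commute_pow_pow_of_commutatorElement_mem (q := p ^ s) h0
      (fun i r hr => by
        have hrR : r ∈ R := hlast ▸ hmono (Fin.le_last i) hr
        rw [← hs]
        exact congrArg Subtype.val (pow_card_eq_one' (x := (⟨r, hrR⟩ : R))))
      (fun i x hx r hr => (hc i).commutatorElement_mem (hn _) (hn _) hx hr) hx (Fin.last m) r
      (hlast ▸ hr)
    rw [Fin.val_last, ← pow_mul] at this
    exact this.symm.eq
  have hle : commutator N ≤ (P : Subgroup N) ⊔ C := by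
    have hK : IsPGroup p ((commutator N).map (QuotientGroup.mk' C)) := by
      rintro ⟨_, x, hx, rfl⟩
      refine ⟨s * m, Subtype.ext ?_⟩
      have := hpow x hx
      rw [← QuotientGroup.ker_mk' C, MonoidHom.mem_ker, map_pow] at this
      exact this
    have : ((commutator N).map (QuotientGroup.mk' C)).Normal :=
      Subgroup.Normal.map inferInstance _ (QuotientGroup.mk'_surjective C)
    have hle := hK.le_sylow_of_normal (P.mapSurjective (QuotientGroup.mk'_surjective C))
    rw [Sylow.coe_mapSurjective, Subgroup.map_le_map_iff, QuotientGroup.ker_mk'] at hle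
    exact hle
  have hM : ((P : Subgroup N) ⊔ C).Normal := Subgroup.Normal.of_commutator_le _ hle
  have htop := P.normalizer_sup_eq_top' (N := (P : Subgroup N) ⊔ C) le_sup_left
  have hP : (P : Subgroup N) ≤ Subgroup.normalizer (P : Set N) := Subgroup.le_normalizer
  rw [← sup_assoc, sup_eq_left.mpr hP] at htop
  exact Subgroup.mem_sup_of_normal_right.mp (htop ▸ Subgroup.mem_top y)

theorem CyclicFactor.inf {G : Type*} [Group G] {A B : Subgroup G} (hA : (A.subgroupOf B).Normal)
    (h : CyclicFactor A B) (R : Subgroup G) : CyclicFactor (A ⊓ R) (B ⊓ R) := by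
  obtain ⟨x, hx, hgen⟩ := h
  have hcyc : IsCyclic (B ⧸ A.subgroupOf B) := by
    refine ⟨QuotientGroup.mk ⟨x, hx⟩, fun b => ?_⟩
    induction b using QuotientGroup.induction_on with
    | H b =>
      obtain ⟨n, hn⟩ := hgen b b.2
      have hb : (QuotientGroup.mk b : B ⧸ A.subgroupOf B) = QuotientGroup.mk (⟨x, hx⟩ ^ n) :=
        QuotientGroup.eq.mpr hn
      exact ⟨n, hb.symm⟩
  have hsub := Subgroup.isCyclic ((R.subgroupOf B).map (QuotientGroup.mk' (A.subgroupOf B)))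
  rw [Subgroup.isCyclic_iff_exists_zpowers_eq_top] at hsub
  obtain ⟨_, hg⟩ := hsub
  obtain ⟨w, hw, rfl⟩ := hg ▸ Subgroup.mem_zpowers _
  refine ⟨w, ⟨w.2, hw⟩, fun y hy => ?_⟩
  have hy' := Subgroup.mem_map_of_mem (QuotientGroup.mk' (A.subgroupOf B))
    (show (⟨y, hy.1⟩ : B) ∈ R.subgroupOf B from hy.2)
  rw [← hg] at hy'
  obtain ⟨n, hn⟩ := Subgroup.mem_zpowers_iff.mp hy'
  refine ⟨n, ?_, R.mul_mem (R.inv_mem hy.2) (R.zpow_mem hw n)⟩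
  rw [← map_zpow] at hn
  have hmem := QuotientGroup.eq.mp hn.symm
  exact hmem

theorem IsSylowIn.exists_sylow {G : Type*} [Group G] {p : ℕ} {H Q : Subgroup G}
    (hQ : IsSylowIn p H Q) : ∃ P : Sylow p H, (P : Subgroup H) = Q.subgroupOf H := by
  refine ⟨⟨Q.subgroupOf H, hQ.2.1.comap_subtype, fun {X} hX hle => ?_⟩, rfl⟩
  have hmap := hQ.2.2 (X.map H.subtype) (Subgroup.map_subtype_le X) (hX.map _) (by
    rw [← Subgroup.map_subgroupOf_eq_of_le hQ.1]
    exact Subgroup.map_mono hle)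
  rw [← hmap, Subgroup.subgroupOf, Subgroup.comap_map_eq_self_of_injective H.subtype_injective]

theorem Sylow.isSylowIn_map_subtype {G : Type*} [Group G] {p : ℕ} {H : Subgroup G}
    (P : Sylow p H) : IsSylowIn p H ((P : Subgroup H).map H.subtype) := by
  refine ⟨Subgroup.map_subtype_le _, P.isPGroup'.map _, fun X hX hXp hle => ?_⟩
  have := P.is_maximal' (Q := X.subgroupOf H) hXp.comap_subtype
    (Subgroup.map_le_iff_le_comap.mp hle)
  rw [← this]
  exact (Subgroup.map_subgroupOf_eq_of_le hX).symm

theorem IsSylowIn.exists_ge {G : Type*} [Group G] {p : ℕ} {H X : Subgroup G} (hX : X ≤ H)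
    (hXp : IsPGroup p X) : ∃ Q, IsSylowIn p H Q ∧ X ≤ Q := by
  have hp : IsPGroup p (X.subgroupOf H) := hXp.comap_subtype
  obtain ⟨P, hP⟩ := hp.exists_le_sylow
  refine ⟨_, P.isSylowIn_map_subtype, ?_⟩
  rw [← Subgroup.map_subgroupOf_eq_of_le hX]
  exact Subgroup.map_mono hP

theorem mem_conj_smul {G : Type*} [Group G] {P : Subgroup G} {t x : G} :
    x ∈ MulAut.conj t • P ↔ t⁻¹ * x * t ∈ P := by
  rw [Subgroup.mem_pointwise_smul_iff_inv_smul_mem, ← map_inv, MulAut.smul_def, MulAut.conj_apply,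
    inv_inv]

theorem conj_smul_le_iff {G : Type*} [Group G] {P Q : Subgroup G} {t : G} :
    MulAut.conj t • P ≤ Q ↔ ∀ x ∈ P, t * x * t⁻¹ ∈ Q :=
  Subgroup.map_le_iff_le_comap

theorem mem_normalizer_of_forall_conj_mem {G : Type*} [Group G] [Finite G] {P : Subgroup G}
    {t : G} (h : ∀ x ∈ P, t * x * t⁻¹ ∈ P) : t ∈ Subgroup.normalizer (P : Set G) := by
  rw [Subgroup.mem_normalizer_iff_map_conj_eq]
  exact Subgroup.eq_of_le_of_card_ge (conj_smul_le_iff.mpr h)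
    (Subgroup.card_map_of_injective (MulAut.conj t).injective).ge

theorem normalizer_conj_smul {G : Type*} [Group G] (P : Subgroup G) (t : G) :
    Subgroup.normalizer ((MulAut.conj t • P : Subgroup G) : Set G) =
      MulAut.conj t • Subgroup.normalizer (P : Set G) := by
  rw [Subgroup.pointwise_smul_def, Subgroup.pointwise_smul_def]
  exact (Subgroup.map_equiv_normalizer_eq P (MulAut.conj t)).symm

theorem IsSylowIn.conj_smul {G : Type*} [Group G] {p : ℕ} {H Q : Subgroup G}
    (hQ : IsSylowIn p H Q) (t : G) : IsSylowIn p (MulAut.conj t • H) (MulAut.conj t • Q) := by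
  refine ⟨Subgroup.pointwise_smul_le_pointwise_smul_iff.mpr hQ.1, hQ.2.1.map _,
    fun X hX hXp hle => ?_⟩
  rw [← inv_smul_eq_iff]
  refine hQ.2.2 _ ?_ (hXp.map _) ?_
  · rwa [Subgroup.pointwise_smul_subset_iff, inv_inv]
  · rwa [← Subgroup.pointwise_smul_subset_iff]

theorem IsSylowIn.exists_conj_smul_le {G : Type*} [Group G] [Finite G] {p : ℕ} [Fact p.Prime]
    {H Q X : Subgroup G} (hQ : IsSylowIn p H Q) (hX : X ≤ H) (hXp : IsPGroup p X) :
    ∃ w ∈ H, MulAut.conj w • X ≤ Q := by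
  obtain ⟨P, hP⟩ := hQ.exists_sylow
  have hp : IsPGroup p (X.subgroupOf H) := hXp.comap_subtype
  obtain ⟨P', hP'⟩ := hp.exists_le_sylow
  obtain ⟨w, hw⟩ := MulAction.exists_smul_eq H P' P
  refine ⟨w, w.2, conj_smul_le_iff.mpr fun x hx => ?_⟩
  have hxP : (⟨x, hX hx⟩ : H) ∈ (P' : Subgroup H) := hP' hx
  have hmem : w * ⟨x, hX hx⟩ * w⁻¹ ∈ (P : Subgroup H) := by
    rw [← hw, Sylow.coe_subgroup_smul, mem_conj_smul]
    simpa [mul_assoc] using hxP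
  rw [hP] at hmem
  exact hmem

theorem IsSylowIn.exists_mem_normalizer_mul_mem_centralizer {G : Type*} [Group G] [Finite G]
    {p : ℕ} [Fact p.Prime] {H Q R : Subgroup G} (hQ : IsSylowIn p H Q) (hRH : R ≤ H)
    (hR : IsPGroup p R) {m : ℕ} {c : Fin (m + 1) → Subgroup G} (hmono : Monotone c) (h0 : c 0 = ⊥)
    (hlast : c (Fin.last m) = R) (hn : ∀ i, ∀ x ∈ c i, ∀ g ∈ H, g * x * g⁻¹ ∈ c i)
    (hc : ∀ i : Fin m, CyclicFactor (c i.castSucc) (c i.succ)) {y : G} (hy : y ∈ H) :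
    ∃ a ∈ Subgroup.normalizer (Q : Set G), ∃ z ∈ Subgroup.centralizer (R : Set G), a * z = y := by
  obtain ⟨P, hP⟩ := hQ.exists_sylow
  have hcH (i) : c i ≤ H := (hmono (Fin.le_last i)).trans (hlast.le.trans hRH)
  obtain ⟨a, ha, z, hz, haz⟩ := P.exists_mem_normalizer_mul_mem_centralizer (R := R.subgroupOf H)
    hR.comap_subtype (c := fun i => (c i).subgroupOf H)
    (fun i j hij => Subgroup.comap_mono (hmono hij)) (by simp [h0]) (by simp only [hlast])
    (fun i => ⟨fun x hx g => hn i x hx g g.2⟩)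
    (fun i => by
      obtain ⟨x, hx, hgen⟩ := hc i
      exact ⟨⟨x, hcH _ hx⟩, hx, fun b hb => hgen b hb⟩) ⟨y, hy⟩
  have haQ : ∀ x ∈ Q, (a : G) * x * (a : G)⁻¹ ∈ Q := fun x hx => by
    have hxP : (⟨x, hQ.1 hx⟩ : H) ∈ (P : Subgroup H) := by rw [hP]; exact hx
    have := (Subgroup.mem_normalizer_iff.mp ha ⟨x, hQ.1 hx⟩).mp hxP
    rw [hP] at this
    exact this
  refine ⟨a, mem_normalizer_of_forall_conj_mem haQ, z, ?_, congrArg Subtype.val haz⟩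
  rw [Subgroup.mem_centralizer_iff] at hz ⊢
  exact fun r hr => congrArg Subtype.val (hz ⟨r, hRH hr⟩ hr)

theorem IsPGroup.lt_inf_normalizer {G : Type*} [Group G] [Finite G] {p : ℕ} [Fact p.Prime]
    {P S : Subgroup G} (hS : IsPGroup p S) (h : P < S) :
    P < S ⊓ Subgroup.normalizer (P : Set G) := by
  have := hS.isNilpotent
  have hlt : P.subgroupOf S < ⊤ := by
    rw [lt_top_iff_ne_top, Ne, Subgroup.subgroupOf_eq_top]
    exact h.not_ge
  obtain ⟨x, hx, hxP⟩ := SetLike.exists_of_lt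
    (Group.normalizerCondition_of_isNilpotent (P.subgroupOf S) hlt)
  refine SetLike.lt_iff_le_and_exists.mpr
    ⟨le_inf h.le Subgroup.le_normalizer, (x : G), Subgroup.mem_inf.mpr ⟨x.2, ?_⟩, hxP⟩
  exact mem_normalizer_of_forall_conj_mem fun y hy =>
    (Subgroup.mem_normalizer_iff.mp hx ⟨y, h.le hy⟩).mp hy

theorem Sylow.exists_mem_normalizer_forall_conj_eq {G : Type*} [Group G] [Finite G] {p : ℕ}
    [Fact p.Prime] (S : Sylow p G) {O : Subgroup G} (hO : O.Normal)
    (hloc : ∀ R : Subgroup G, O ≤ R → R < S →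
      IsSylowIn p (Subgroup.normalizer (R : Set G)) (S ⊓ Subgroup.normalizer (R : Set G)) →
      ∀ y ∈ Subgroup.normalizer (R : Set G),
        ∃ a ∈ Subgroup.normalizer
            ((S ⊓ Subgroup.normalizer (R : Set G) : Subgroup G) : Set G),
          ∃ z ∈ Subgroup.centralizer (R : Set G), a * z = y)
    (P : Subgroup G) (hOP : O ≤ P) (hPS : P ≤ S) (g : G)
    (hg : MulAut.conj g • P ≤ (S : Subgroup G)) :
    ∃ n ∈ Subgroup.normalizer (S : Set G), ∀ x ∈ P, g * x * g⁻¹ = n * x * n⁻¹ := by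
  induction hk : Nat.card S - Nat.card P using Nat.strong_induction_on generalizing P g with
  | _ k ih =>
  obtain rfl | hlt := eq_or_lt_of_le hPS
  · exact ⟨g, mem_normalizer_of_forall_conj_mem (conj_smul_le_iff.mp hg), fun _ _ => rfl⟩
  have hSp := S.isPGroup'
  have hOconj {X : Subgroup G} (hX : O ≤ X) (u : G) : O ≤ MulAut.conj u • X := fun x hx =>
    mem_conj_smul.mpr (hX (by simpa using hO.conj_mem x hx u⁻¹))
  have hcard (X : Subgroup G) (u : G) : Nat.card (MulAut.conj u • X : Subgroup G) = Nat.card X :=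
    Subgroup.card_map_of_injective (MulAut.conj u).injective
  have key (X : Subgroup G) (hOX : O ≤ X) (hXS : X < S) (hXP : Nat.card X = Nat.card P) (u : G)
      (hu : MulAut.conj u • (S ⊓ Subgroup.normalizer (X : Set G) : Subgroup G) ≤ S) :
      ∃ n ∈ Subgroup.normalizer (S : Set G),
        ∀ x ∈ (S ⊓ Subgroup.normalizer (X : Set G) : Subgroup G), u * x * u⁻¹ = n * x * n⁻¹ := by
    have hX := hSp.lt_inf_normalizer hXS
    refine ih _ ?_ _ (hOX.trans hX.le) inf_le_left u hu rfl
    have h1 : Nat.card X < Nat.card (S ⊓ Subgroup.normalizer (X : Set G) : Subgroup G) :=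
      Set.Finite.card_lt_card (Set.toFinite _) hX
    have h2 : Nat.card (S ⊓ Subgroup.normalizer (X : Set G) : Subgroup G) ≤ Nat.card S :=
      Subgroup.card_le_of_le inf_le_left
    omega
  obtain ⟨Q, hQ, hNQ⟩ := IsSylowIn.exists_ge
    (inf_le_right : (S : Subgroup G) ⊓ Subgroup.normalizer (P : Set G) ≤ _) hSp.to_inf_left
  obtain ⟨t, ht⟩ : ∃ t : G, MulAut.conj t • Q ≤ (S : Subgroup G) := by
    obtain ⟨S', hS'⟩ := hQ.2.1.exists_le_sylow
    obtain ⟨t, rfl⟩ := MulAction.exists_smul_eq G S' S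
    exact ⟨t, Subgroup.pointwise_smul_le_pointwise_smul_iff.mpr hS'⟩
  set R := MulAut.conj t • P with hR
  have hRn : Subgroup.normalizer (R : Set G) = _ := normalizer_conj_smul P t
  have hQt := hQ.conj_smul t
  rw [← hRn] at hQt
  have hSR : (S : Subgroup G) ⊓ Subgroup.normalizer (R : Set G) = MulAut.conj t • Q :=
    hQt.2.2 _ inf_le_right hSp.to_inf_left (le_inf ht hQt.1)
  have hPQ : P ≤ Q := (hSp.lt_inf_normalizer hlt).le.trans hNQ
  have hRS : R ≤ S := (Subgroup.pointwise_smul_le_pointwise_smul_iff.mpr hPQ).trans ht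
  have hproper {X : Subgroup G} (hX : X ≤ S) (hXP : Nat.card X = Nat.card P) : X < S := by
    refine lt_of_le_of_ne hX ?_
    rintro rfl
    exact (Set.Finite.card_lt_card (Set.toFinite _) hlt).ne hXP.symm
  have hRS' := hproper hRS (hcard P t)
  rw [← hSR] at hQt
  have hloc' := hloc R (hOconj hOP t) hRS' hQt
  obtain ⟨n₁, hn₁, h₁⟩ := key P hOP hlt rfl t
    ((Subgroup.pointwise_smul_le_pointwise_smul_iff.mpr hNQ).trans ht)
  set P' := MulAut.conj g • P with hP'
  have hP'S := hproper hg (hcard P g)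
  have hconj : MulAut.conj (t * g⁻¹) • P' = R := by
    rw [hP', hR, smul_smul, ← map_mul, inv_mul_cancel_right]
  obtain ⟨w, hw, hwle⟩ := hQt.exists_conj_smul_le
    (X := MulAut.conj (t * g⁻¹) • (S ⊓ Subgroup.normalizer (P' : Set G) : Subgroup G)) (by
      rw [← hconj, normalizer_conj_smul P']
      exact Subgroup.pointwise_smul_le_pointwise_smul_iff.mpr inf_le_right)
    ((hSp.to_inf_left).map _)
  rw [smul_smul, ← map_mul] at hwle
  obtain ⟨n₂, hn₂, h₂⟩ := key P' (hOconj hOP g) hP'S (hcard P g) _ (hwle.trans inf_le_left)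
  obtain ⟨a, ha, z, hz, haz⟩ := hloc' w hw
  obtain ⟨n₃, hn₃, h₃⟩ := key R (hOconj hOP t) hRS' (hcard P t) a
    (conj_smul_le_iff.mpr fun x hx => ((Subgroup.mem_normalizer_iff.mp ha x).mp hx).1)
  refine ⟨n₂⁻¹ * n₃ * n₁, mul_mem (mul_mem (inv_mem hn₂) hn₃) hn₁, fun x hx => ?_⟩
  have e₁ := h₁ x ((hSp.lt_inf_normalizer hlt).le hx)
  have e₂ := h₂ (g * x * g⁻¹) ((hSp.lt_inf_normalizer hP'S).le (conj_smul_le_iff.mp hP'.ge x hx))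
  have hr : t * x * t⁻¹ ∈ R := conj_smul_le_iff.mp hR.ge x hx
  have e₃ := h₃ (t * x * t⁻¹) ((hSp.lt_inf_normalizer hRS').le hr)
  have ez := Subgroup.mem_centralizer_iff.mp hz _ hr
  calc g * x * g⁻¹ = n₂⁻¹ * (n₂ * (g * x * g⁻¹) * n₂⁻¹) * n₂ := by group
    _ = n₂⁻¹ * (w * (t * x * t⁻¹) * w⁻¹) * n₂ := by rw [← e₂]; group
    _ = n₂⁻¹ * (a * (z * (t * x * t⁻¹)) * z⁻¹ * a⁻¹) * n₂ := by rw [← haz]; group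
    _ = n₂⁻¹ * (a * (t * x * t⁻¹) * a⁻¹) * n₂ := by rw [← ez]; group
    _ = n₂⁻¹ * n₃ * n₁ * x * (n₂⁻¹ * n₃ * n₁)⁻¹ := by rw [e₃, e₁]; group

theorem stmt5 {G : Type*} [Group G] [Finite G] (p : ℕ) [Fact p.Prime]
    (S : Sylow p G) (O : Subgroup G)
    (hON : O.Normal) (hOp : IsPGroup p O)
    (hOmax : ∀ N : Subgroup G, N.Normal → IsPGroup p N → N ≤ O)
    (h1 : ∀ H : Subgroup G, H < ⊤ → O < (S : Subgroup G) ⊓ H →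
      IsSylowIn p H ((S : Subgroup G) ⊓ H) → FusionSupersolvableIn H ((S : Subgroup G) ⊓ H))
    (h2 : ∃ (n : ℕ) (c : Fin (n + 1) → Subgroup G), Monotone c ∧ c 0 = ⊥ ∧
      c (Fin.last n) = O ∧ (∀ i, (c i).Normal) ∧
      ∀ i : Fin n, CyclicFactor (c i.castSucc) (c i.succ)) :
    FusionSupersolvableIn ⊤ (S : Subgroup G) := by
  have hOS : O ≤ S := hOp.le_sylow_of_normal S
  obtain ⟨n, c, hcm, hc0, hcl, hcn, hcc⟩ := h2
  obtain rfl | hlt := eq_or_lt_of_le hOS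
  · exact ⟨n, c, hcm, hc0, hcl, fun i => ⟨hcl ▸ hcm (Fin.le_last i),
      fun x hx g _ _ => by simpa using (hcn i).conj_mem x hx g⁻¹⟩, hcc⟩
  have hSp := S.isPGroup'
  have hloc (R : Subgroup G) (hOR : O ≤ R) (hRS : R < S)
      (hR : IsSylowIn p (Subgroup.normalizer (R : Set G)) (S ⊓ Subgroup.normalizer (R : Set G)))
      (y : G) (hy : y ∈ Subgroup.normalizer (R : Set G)) :
      ∃ a ∈ Subgroup.normalizer ((S ⊓ Subgroup.normalizer (R : Set G) : Subgroup G) : Set G),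
        ∃ z ∈ Subgroup.centralizer (R : Set G), a * z = y := by
    have hRp : IsPGroup p R := hSp.to_le hRS.le
    by_cases htop : Subgroup.normalizer (R : Set G) = ⊤
    · have hRO : R = O := le_antisymm (hOmax R (Subgroup.normalizer_eq_top_iff.mp htop) hRp) hOR
      exact hR.exists_mem_normalizer_mul_mem_centralizer Subgroup.le_normalizer hRp hcm hc0
        (hcl.trans hRO.symm) (fun i x hx g _ => (hcn i).conj_mem x hx g) hcc hy
    · have hRN := hSp.lt_inf_normalizer hRS
      obtain ⟨m, d, hdm, hd0, hdl, hdc, hdf⟩ :=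
        h1 _ (lt_top_iff_ne_top.mpr htop) (hOR.trans_lt hRN) hR
      refine hR.exists_mem_normalizer_mul_mem_centralizer Subgroup.le_normalizer hRp
        (c := fun i => d i ⊓ R) (fun i j hij => inf_le_inf_right _ (hdm hij)) (by simp [hd0])
        (by simpa only [hdl, inf_eq_right] using hRN.le) (fun i x hx u hu => ?_)
        (fun i => (hdf i).inf ?_ R) hy
      · have hxR := (Subgroup.mem_normalizer_iff.mp hu x).mp hx.2
        refine ⟨?_, hxR⟩
        simpa using (hdc i).2 x hx.1 u⁻¹ (inv_mem hu) (by simpa using hRN.le hxR)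
      · refine ⟨fun x hx b => ?_⟩
        have hb := (hdc _).1 b.2
        have hxS := (hdc _).1 hx
        have := (hdc i.castSucc).2 x hx (b : G)⁻¹ (inv_mem hb.2)
          (mul_mem (mul_mem (inv_mem (inv_mem hb)) hxS) (inv_mem hb))
        simpa [Subgroup.mem_subgroupOf] using this
  have hN : Subgroup.normalizer (S : Set G) ≠ ⊤ := fun h =>
    hlt.not_ge (hOmax S (Subgroup.normalizer_eq_top_iff.mp h) hSp)
  have hSN : (S : Subgroup G) ⊓ Subgroup.normalizer (S : Set G) = S :=
    inf_eq_left.mpr Subgroup.le_normalizer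
  have hS := h1 (Subgroup.normalizer (S : Set G)) (lt_top_iff_ne_top.mpr hN)
  rw [hSN] at hS
  obtain ⟨m, d, hdm, hd0, hdl, hdc, hdf⟩ := hS hlt
    ⟨Subgroup.le_normalizer, hSp, fun Q _ hQ hle => S.is_maximal' hQ hle⟩
  refine ⟨m, d, hdm, hd0, hdl, fun i => ⟨(hdc i).1, fun x hx g _ hg => ?_⟩, hdf⟩
  obtain ⟨u, hu, hux⟩ := S.exists_mem_normalizer_forall_conj_eq hON hloc
    (Subgroup.zpowers x ⊔ O) le_sup_right
    (sup_le (Subgroup.zpowers_le.mpr ((hdc i).1 hx)) hOS) g⁻¹ (by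
      rw [Subgroup.smul_sup, sup_le_iff]
      refine ⟨?_, conj_smul_le_iff.mpr fun y hy => hOS (hON.conj_mem y hy _)⟩
      rw [Subgroup.pointwise_smul_subset_iff, Subgroup.zpowers_le, ← map_inv, mem_conj_smul]
      simpa using hg)
  have hxu := hux x (Subgroup.mem_sup_left (Subgroup.mem_zpowers x))
  rw [inv_inv] at hxu
  rw [hxu] at hg ⊢
  simpa using (hdc i).2 x hx u⁻¹ (inv_mem hu) (by simpa using hg)
end

section
/- Let p be an odd prime, let H be a subgroup of GL_2(F_p) containing SL_2(F_p), let V be the additive group of row vectors (x y) with x, y ∈ F_p, and let G = V ⋊ H be the semidirect product with respect to the natural action of H on V (multiplication (h_1, v_1)·(h_2, v_2) = (h_1 h_2, v_1 h_2 + v_2)). Let U = {[[1, a], [0, 1]] : a ∈ F_p} ≤ SL_2(F_p) ≤ H and S = {(u, v) : u ∈ U, v ∈ V} ≤ G. Then S is a Sylow p-subgroup of G, and there exist a maximal subgroup S_1 of S and an element g ∈ G such that g⁻¹S_1g ≤ S and g⁻¹S_1g ≠ S_1 (so S_1 is not weakly closed in S with respect to G). -/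
open Matrix

variable {p : ℕ}

/-- The underlying set of the semidirect product `G = V ⋊ H`: pairs `(h, v)` with
`h ∈ H` and `v` a row vector. -/
def PaperG (H : Subgroup (Matrix.GeneralLinearGroup (Fin 2) (ZMod p))) : Type :=
  H × (Fin 2 → ZMod p)

/-- The matrix of an element of `H`. -/
def mat {H : Subgroup (Matrix.GeneralLinearGroup (Fin 2) (ZMod p))} (h : H) :
    Matrix (Fin 2) (Fin 2) (ZMod p) :=
  ((h : Matrix.GeneralLinearGroup (Fin 2) (ZMod p)) : Matrix (Fin 2) (Fin 2) (ZMod p))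

instance paperGroup (H : Subgroup (Matrix.GeneralLinearGroup (Fin 2) (ZMod p))) :
    Group (PaperG H) where
  mul a b := (a.1 * b.1, a.2 ᵥ* mat b.1 + b.2)
  one := (1, 0)
  inv a := (a.1⁻¹, -(a.2 ᵥ* mat a.1⁻¹))
  mul_assoc a b c := by
    show (_, _) = (_, _)
    refine Prod.ext (mul_assoc _ _ _) ?_
    show (a.2 ᵥ* mat b.1 + b.2) ᵥ* mat c.1 + c.2 = a.2 ᵥ* mat (b.1 * c.1) + (b.2 ᵥ* mat c.1 + c.2)
    simp [mat, Matrix.add_vecMul, Matrix.vecMul_vecMul, add_assoc, Units.val_mul]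
  one_mul a := by
    show (_, _) = _
    refine Prod.ext (one_mul _) ?_
    show (0 : Fin 2 → ZMod p) ᵥ* mat a.1 + a.2 = a.2
    simp
  mul_one a := by
    refine Prod.ext (mul_one _) ?_
    show a.2 ᵥ* mat (1 : H) + 0 = a.2
    simp [mat, Units.val_one]
  inv_mul_cancel a := by
    refine Prod.ext (inv_mul_cancel _) ?_
    show (-(a.2 ᵥ* mat a.1⁻¹)) ᵥ* mat a.1 + a.2 = 0
    simp [mat, Matrix.neg_vecMul, Matrix.vecMul_vecMul, ← Units.val_mul]

instance (H : Subgroup (Matrix.GeneralLinearGroup (Fin 2) (ZMod p))) [NeZero p] :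
    Finite (PaperG H) :=
  inferInstanceAs (Finite (H × (Fin 2 → ZMod p)))

/-- The subgroup `S = {(u, v) : u ∈ U, v ∈ V}` of `G`, where
`U = {[[1, a], [0, 1]] : a ∈ F_p}`. -/
def paperS (H : Subgroup (Matrix.GeneralLinearGroup (Fin 2) (ZMod p))) :
    Subgroup (PaperG H) where
  carrier := {g : PaperG H | ∃ a : ZMod p, mat g.1 = !![1, a; 0, 1]}
  one_mem' := ⟨0, by
    show mat (1 : H) = _
    simp [mat, Units.val_one, Matrix.one_fin_two]⟩
  mul_mem' := by
    rintro g h ⟨x, hx⟩ ⟨y, hy⟩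
    refine ⟨y + x, ?_⟩
    show mat (g.1 * h.1) = _
    have : mat (g.1 * h.1) = mat g.1 * mat h.1 := by simp [mat]
    rw [this, hx, hy]
    simp [Matrix.mul_fin_two]
  inv_mem' := by
    rintro g ⟨x, hx⟩
    refine ⟨-x, ?_⟩
    show mat g.1⁻¹ = _
    have h1 : (mat g.1) * !![1, -x; 0, 1] = 1 := by
      rw [hx]; simp [Matrix.mul_fin_two, Matrix.one_fin_two]
    have : mat g.1⁻¹ = Units.val ((g.1 : Matrix.GeneralLinearGroup (Fin 2) (ZMod p))⁻¹) := by
      simp [mat]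
    rw [this]
    exact Units.inv_eq_of_mul_eq_one_right h1

/-- The conjugate subgroup `gHg⁻¹`. -/
def subgroupConj {G : Type*} [Group G] (g : G) (H : Subgroup G) : Subgroup G :=
  H.map (MulAut.conj g).toMonoidHom

namespace PaperG

variable {H : Subgroup (Matrix.GeneralLinearGroup (Fin 2) (ZMod p))}

/-- The element `(h, v)` of `G`. -/
def mk (h : H) (v : Fin 2 → ZMod p) : PaperG H := (h, v)

theorem fst_mul (a b : PaperG H) : (a * b).1 = a.1 * b.1 := rfl

theorem snd_mul (a b : PaperG H) : (a * b).2 = a.2 ᵥ* mat b.1 + b.2 := rfl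

theorem mat_mul (a b : H) : mat (a * b) = mat a * mat b := by simp [mat]

theorem mat_injective : Function.Injective (mat (H := H)) :=
  fun _ _ h => Subtype.ext (Units.ext h)

theorem exists_mat_eq (hSL : (Matrix.SpecialLinearGroup.toGL
    (n := Fin 2) (R := ZMod p)).range ≤ H) (A : Matrix (Fin 2) (Fin 2) (ZMod p))
    (hA : A.det = 1) : ∃ h : H, mat h = A :=
  ⟨⟨Matrix.SpecialLinearGroup.toGL ⟨A, hA⟩, hSL ⟨⟨A, hA⟩, rfl⟩⟩, rfl⟩

/-- The homomorphism from `S` to the additive group of `F_p` sending the pair of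
`[[1, a], [0, 1]]` and `(x y)` to `x - a`. -/
def differenceHom (H : Subgroup (Matrix.GeneralLinearGroup (Fin 2) (ZMod p))) :
    paperS H →* Multiplicative (ZMod p) :=
  MonoidHom.mk' (fun s => Multiplicative.ofAdd (s.1.2 0 - mat s.1.1 0 1)) (by
    rintro ⟨s, a, ha⟩ ⟨t, b, hb⟩
    apply Multiplicative.toAdd.injective
    simp only [Subgroup.coe_mul, fst_mul, snd_mul, mat_mul, ha, hb,
      toAdd_mul, toAdd_ofAdd]
    simp [Matrix.vecHead]
    ring)

theorem mem_map_ker_differenceHom {g : PaperG H} :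
    g ∈ (differenceHom H).ker.map (paperS H).subtype ↔
      mat g.1 = !![1, g.2 0; 0, 1] := by
  simp only [Subgroup.mem_map, Subgroup.coe_subtype, Subtype.exists, exists_and_right,
    exists_eq_right, MonoidHom.mem_ker]
  constructor
  · rintro ⟨⟨a, ha⟩, h⟩
    have h' : g.2 0 - mat g.1 0 1 = 0 := h
    rw [ha] at h' ⊢
    simp at h'
    rw [sub_eq_zero.mp h']
  · intro h
    refine ⟨⟨_, h⟩, ?_⟩
    change g.2 0 - mat g.1 0 1 = 0
    simp [h]

theorem card_paperS [Fact p.Prime] (hSL : (Matrix.SpecialLinearGroup.toGL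
    (n := Fin 2) (R := ZMod p)).range ≤ H) : Nat.card (paperS H) = p ^ 3 := by
  have hb : Function.Bijective (fun s : paperS H => (mat s.1.1 0 1, s.1.2)) := by
    constructor
    · rintro ⟨s, a, ha⟩ ⟨t, b, hb⟩ h
      simp only [Prod.mk.injEq] at h
      obtain ⟨h1, h2⟩ := h
      refine Subtype.ext (Prod.ext (mat_injective ?_) h2)
      simp only [ha, hb] at h1 ⊢
      simp at h1
      rw [h1]
    · rintro ⟨a, v⟩
      obtain ⟨h, hh⟩ := exists_mat_eq hSL !![1, a; 0, 1] (by simp)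
      exact ⟨⟨(h, v), a, hh⟩, by simp [hh]⟩
  rw [Nat.card_congr (Equiv.ofBijective _ hb)]
  simp
  ring

theorem not_dvd_index_paperS [Fact p.Prime] (hSL : (Matrix.SpecialLinearGroup.toGL
    (n := Fin 2) (R := ZMod p)).range ≤ H) : ¬ p ∣ (paperS H).index := by
  have hp := Fact.out (p := p.Prime)
  have hG : Nat.card (PaperG H) = Nat.card H * p ^ 2 := by
    change Nat.card (H × (Fin 2 → ZMod p)) = _
    simp [Nat.card_prod]
  have hGL : Nat.card H ∣ (p ^ 2 - 1) * (p ^ 2 - p) := by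
    have h := H.card_subgroup_dvd_card
    rw [Matrix.card_GL_field] at h
    simpa [Fin.prod_univ_two, ZMod.card] using h
  have hsub : p ^ 2 - p = p * (p - 1) := by rw [Nat.mul_sub, mul_one, sq]
  have hdvd : (paperS H).index ∣ (p ^ 2 - 1) * (p - 1) := by
    have h := (paperS H).card_mul_index
    rw [card_paperS hSL, hG] at h
    refine Nat.dvd_of_mul_dvd_mul_left (pow_pos hp.pos 3) (h ▸ ?_)
    convert Nat.mul_dvd_mul_right hGL (p ^ 2) using 1
    rw [hsub]
    ring
  intro h
  rcases hp.dvd_mul.mp (h.trans hdvd) with h | h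
  · rw [Nat.dvd_sub_iff_right (Nat.one_le_pow _ _ hp.pos) (dvd_pow_self p two_ne_zero)] at h
    exact hp.one_lt.ne' (Nat.dvd_one.mp h)
  · exact absurd (Nat.le_of_dvd (by have := hp.two_le; omega) h) (by have := hp.pos; omega)

theorem eq_or_eq_of_map_ker_le [Fact p.Prime] {G : Type*} [Group G] {S T : Subgroup G}
    (f : S →* Multiplicative (ZMod p)) (hT : f.ker.map S.subtype ≤ T) (hTS : T ≤ S) :
    T = f.ker.map S.subtype ∨ T = S := by
  refine or_iff_not_imp_left.mpr fun hne => le_antisymm hTS fun s hs => ?_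
  obtain ⟨t, ht, htk⟩ := Set.not_subset.mp fun h => hne (le_antisymm h hT)
  have hft : (f ⟨t, hTS ht⟩).toAdd ≠ 0 := fun h => htk ⟨⟨t, hTS ht⟩, h, rfl⟩
  set k := ((f ⟨s, hs⟩).toAdd / (f ⟨t, hTS ht⟩).toAdd).val with hk
  have hker : (⟨s, hs⟩ * (⟨t, hTS ht⟩ ^ k)⁻¹ : S) ∈ f.ker := by
    rw [MonoidHom.mem_ker, map_mul, map_inv, mul_inv_eq_one, map_pow]
    apply Multiplicative.toAdd.injective
    rw [toAdd_pow, nsmul_eq_mul, hk, ZMod.natCast_zmod_val, div_mul_cancel₀ _ hft]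
  have hmem : s * (t ^ k)⁻¹ ∈ T := hT ⟨_, hker, rfl⟩
  simpa using T.mul_mem hmem (T.pow_mem ht k)

theorem conj_neg_one {h : H} (hh : mat h = -1) (x : PaperG H) :
    MulAut.conj ((mk h 0)⁻¹) x = mk x.1 (-x.2) := by
  rw [MulAut.conj_apply, inv_inv, mul_assoc, inv_mul_eq_iff_eq_mul]
  refine Prod.ext (mat_injective ?_) ?_
  · change mat (x.1 * h) = mat (h * x.1)
    simp [mat_mul, hh]
  · change x.2 ᵥ* mat h + 0 = 0 ᵥ* mat x.1 + -x.2
    simp [hh, Matrix.vecMul_neg]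

end PaperG

theorem stmt6 (p : ℕ) [Fact p.Prime] (hp : Odd p)
    (H : Subgroup (Matrix.GeneralLinearGroup (Fin 2) (ZMod p)))
    (hSL : (Matrix.SpecialLinearGroup.toGL
      (n := Fin 2) (R := ZMod p)).range ≤ H) :
    (∃ P : Sylow p (PaperG H), (P : Subgroup (PaperG H)) = paperS H) ∧
      ∃ S₁ : Subgroup (PaperG H), S₁ < paperS H ∧
        (∀ T : Subgroup (PaperG H), S₁ ≤ T → T ≤ paperS H → T = S₁ ∨ T = paperS H) ∧
        ∃ g : PaperG H, subgroupConj g⁻¹ S₁ ≤ paperS H ∧ subgroupConj g⁻¹ S₁ ≠ S₁ := by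
  open PaperG in
  refine ⟨⟨(IsPGroup.of_card (card_paperS hSL)).toSylow (not_dvd_index_paperS hSL), rfl⟩,
    (differenceHom H).ker.map (paperS H).subtype, ?_, ?_, ?_⟩
  · refine lt_of_le_of_ne (Subgroup.map_subtype_le _) fun h => ?_
    have hmem : (mk 1 fun _ => 1 : PaperG H) ∈ paperS H :=
      ⟨0, by simp [mk, mat, Matrix.one_fin_two]⟩
    rw [← h, mem_map_ker_differenceHom] at hmem
    have := congrFun (congrFun hmem 0) 1
    simp [mk, mat] at this
  · exact fun T => eq_or_eq_of_map_ker_le _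
  obtain ⟨h, hh⟩ := exists_mat_eq hSL (-1) (by simp [Matrix.det_neg])
  refine ⟨mk h 0, ?_, fun heq => ?_⟩
  · rintro _ ⟨x, hx, rfl⟩
    have hx' := mem_map_ker_differenceHom.mp hx
    change MulAut.conj ((mk h 0)⁻¹) x ∈ _
    rw [conj_neg_one hh]
    exact ⟨_, hx'⟩
  · obtain ⟨u, hu⟩ := exists_mat_eq hSL !![1, 1; 0, 1] (by simp)
    have hx : mk u (fun _ => 1) ∈ (differenceHom H).ker.map (paperS H).subtype :=
      mem_map_ker_differenceHom.mpr hu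
    have hy : MulAut.conj ((mk h 0)⁻¹) (mk u fun _ => 1) ∈
        (differenceHom H).ker.map (paperS H).subtype := heq ▸ ⟨_, hx, rfl⟩
    rw [conj_neg_one hh, mem_map_ker_differenceHom] at hy
    have h1 := congrFun (congrFun hy 0) 1
    change mat u 0 1 = -1 at h1
    have h2 : (1 : ZMod p) = -1 := by rwa [hu] at h1
    have : Fact (2 < p) :=
      ⟨lt_of_le_of_ne (Fact.out (p := p.Prime)).two_le (by rintro rfl; exact absurd hp (by decide))⟩
    exact ZMod.neg_one_ne_one h2.symm
end

section
/- Let G be a minimal nonnilpotent finite group, i.e., G is not nilpotent but every proper subgroup of G is nilpotent, and let S be a Sylow subgroup of G (for some prime q) that is not normal in G. Then S is cyclic. -/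
/-- A Sylow subgroup contained in a nilpotent normal subgroup is normal. -/
theorem Sylow.normal_of_le_of_isNilpotent {G : Type*} [Group G] [Finite G] {p : ℕ}
    [Fact p.Prime] (P : Sylow p G) {M : Subgroup G} [M.Normal] [Group.IsNilpotent M]
    (hPM : (P : Subgroup G) ≤ M) : (P : Subgroup G).Normal := by
  have h : ((P.subtype hPM : Sylow p M) : Subgroup M).Normal := inferInstance
  rw [Sylow.coe_subtype, Subgroup.normal_subgroupOf_iff_le_normalizer hPM] at h
  rw [← Subgroup.normalizer_eq_top_iff, ← P.normalizer_sup_eq_top' hPM]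
  exact (sup_eq_left.mpr h).symm

/-- In a finite nilpotent group, elements lying in `p`-subgroups for distinct primes commute. -/
theorem Group.IsNilpotent.commute_of_isPGroup {G : Type*} [Group G] [Finite G]
    [Group.IsNilpotent G] {p q : ℕ} [Fact p.Prime] [Fact q.Prime] (hpq : p ≠ q)
    {A B : Subgroup G} (hA : IsPGroup p A) (hB : IsPGroup q B) {a b : G}
    (ha : a ∈ A) (hb : b ∈ B) : Commute a b := by
  obtain ⟨P, hP⟩ := hA.exists_le_sylow
  obtain ⟨Q, hQ⟩ := hB.exists_le_sylow
  exact Subgroup.commute_of_normal_of_disjoint (P : Subgroup G) Q inferInstance inferInstance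
    (IsPGroup.disjoint_of_ne p q hpq _ _ P.isPGroup' Q.isPGroup') a b (hP ha) (hQ hb)

/-- A proper subgroup of a nilpotent subgroup is properly contained in its normalizer there. -/
theorem Subgroup.lt_inf_normalizer_of_isNilpotent {G : Type*} [Group G] {D A : Subgroup G}
    [Group.IsNilpotent A] (h : D < A) : D < A ⊓ Subgroup.normalizer (D : Set G) := by
  refine lt_of_le_of_ne (le_inf h.le Subgroup.le_normalizer) fun heq ↦ ?_
  have hlt : D.subgroupOf A < ⊤ := by
    rw [lt_top_iff_ne_top, Ne, Subgroup.subgroupOf_eq_top]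
    exact h.not_ge
  have hn := Group.normalizerCondition_of_isNilpotent (G := A) (D.subgroupOf A) hlt
  rw [← Subgroup.subgroupOf_normalizer_eq h.le] at hn
  refine hn.not_ge fun x hx ↦ ?_
  rw [Subgroup.mem_subgroupOf] at hx ⊢
  rw [heq]
  exact ⟨x.2, hx⟩

/-- In a finite simple group all of whose proper subgroups are nilpotent, distinct maximal
subgroups intersect trivially. -/
theorem IsSimpleGroup.inf_eq_bot_of_isCoatom {G : Type*} [Group G] [Finite G] [IsSimpleGroup G]
    (hmin : ∀ H : Subgroup G, H < ⊤ → Group.IsNilpotent H) {A B : Subgroup G}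
    (hA : IsCoatom A) (hB : IsCoatom B) (hAB : A ≠ B) : A ⊓ B = ⊥ := by
  by_contra hne
  let T : Set (Subgroup G × Subgroup G) :=
    {X | IsCoatom X.1 ∧ IsCoatom X.2 ∧ X.1 ≠ X.2 ∧ X.1 ⊓ X.2 ≠ ⊥}
  obtain ⟨⟨C, E⟩, ⟨hC, hE, hCE, hD⟩, hmax⟩ :=
    T.toFinite.exists_maximalFor (fun X ↦ X.1 ⊓ X.2) T ⟨(A, B), hA, hB, hAB, hne⟩
  dsimp only at hC hE hCE hD hmax
  have hnorm : Subgroup.normalizer ((C ⊓ E : Subgroup G) : Set G) ≠ ⊤ := fun h ↦ by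
    rcases (Subgroup.normalizer_eq_top_iff.mp h).eq_bot_or_eq_top with h | h
    · exact hD h
    · exact hC.1 (top_le_iff.mp (h ▸ inf_le_left))
  obtain ⟨F, hF, hle⟩ := (eq_top_or_exists_le_coatom _).resolve_left hnorm
  have key : ∀ X, IsCoatom X → C ⊓ E < X → X = F := fun X hX hlt ↦ by
    by_contra hXF
    have := hmin X hX.lt_top
    have hlt' : C ⊓ E < X ⊓ F :=
      (Subgroup.lt_inf_normalizer_of_isNilpotent hlt).trans_le (inf_le_inf_left _ hle)
    exact hlt'.not_ge (hmax (j := (X, F)) ⟨hX, hF, hXF, (bot_le.trans_lt hlt').ne'⟩ hlt'.le)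
  refine hCE ((key C hC ?_).trans (key E hE ?_).symm)
  · exact inf_lt_left.mpr fun h ↦ hCE ((hC.le_iff.mp h).resolve_left hE.1).symm
  · exact inf_lt_right.mpr fun h ↦ hCE ((hE.le_iff.mp h).resolve_left hC.1)

/-- A finite simple group all of whose proper subgroups are nilpotent is solvable. -/
theorem IsSimpleGroup.isSolvable_of_forall_isNilpotent {G : Type*} [Group G] [Finite G]
    [IsSimpleGroup G] (hmin : ∀ H : Subgroup G, H < ⊤ → Group.IsNilpotent H) :
    Group.IsSolvable G := by
  by_contra hns
  have hcomm : commutator G = ⊤ := by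
    refine (Subgroup.Normal.eq_bot_or_eq_top inferInstance).resolve_left fun h ↦ hns ?_
    exact Group.isSolvable_of_comm fun a b ↦
      commutatorElement_eq_one_iff_mul_comm.mp (Subgroup.mem_bot.mp
        (h ▸ Subgroup.commutator_mem_commutator (Subgroup.mem_top a) (Subgroup.mem_top b)))
  obtain ⟨p, hp, hdvd⟩ := Nat.exists_prime_and_dvd (Finite.one_lt_card (α := G)).ne'
  have : Fact p.Prime := ⟨hp⟩
  obtain ⟨P⟩ : Nonempty (Sylow p G) := inferInstance
  have hPbot : (P : Subgroup G) ≠ ⊥ := P.ne_bot_of_dvd_card hdvd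
  have hPtop : (P : Subgroup G) ≠ ⊤ := fun h ↦ hns <| by
    have hnil : Group.IsNilpotent (P : Subgroup G) := P.isPGroup'.isNilpotent
    rw [h] at hnil
    have := Group.isNilpotent_top.mp hnil
    infer_instance
  obtain ⟨M, hM, hPM⟩ := (eq_top_or_exists_le_coatom _).resolve_left hPtop
  have hself : Subgroup.normalizer (M : Set G) = M := by
    refine (hM.le_iff.mp Subgroup.le_normalizer).resolve_left fun h ↦ ?_
    rcases (Subgroup.normalizer_eq_top_iff.mp h).eq_bot_or_eq_top with h | h
    · exact hPbot (le_bot_iff.mp (h ▸ hPM))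
    · exact hM.1 h
  have hfoc : (P : Subgroup G) ≤ ⁅(P : Subgroup G), M⁆ := by
    have h := Subgroup.commutator_inf_eq_focalSubgroup P
    rw [hcomm, top_inf_eq] at h
    conv_lhs => rw [h]
    rw [Subgroup.focalSubgroup_def, Subgroup.closure_le]
    rintro - ⟨hg, x, hx, u, rfl⟩
    rcases eq_or_ne x 1 with rfl | hx1
    · simp
    refine Subgroup.commutator_mem_commutator hx ?_
    have hconj : u * x * u⁻¹ ∈ M := hPM <| by
      have := mul_mem (inv_mem hg) hx
      rwa [commutatorElement_def, show (x * u * x⁻¹ * u⁻¹)⁻¹ * x = u * x * u⁻¹ by group] at this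
    have hM' : IsCoatom (M.map (MulAut.conj u).toMonoidHom) :=
      (OrderIso.isCoatom_iff (MulAut.conj u).mapSubgroup M).mpr hM
    have heq : M.map (MulAut.conj u).toMonoidHom = M := by
      by_contra hne
      have hbot := IsSimpleGroup.inf_eq_bot_of_isCoatom hmin hM' hM hne
      have hmem : u * x * u⁻¹ ∈ M.map (MulAut.conj u).toMonoidHom ⊓ M :=
        ⟨⟨x, hPM hx, rfl⟩, hconj⟩
      rw [hbot, Subgroup.mem_bot, conj_eq_one_iff] at hmem
      exact hx1 hmem
    rw [← hself, Subgroup.mem_normalizer_iff]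
    intro h
    constructor
    · intro hh
      rw [← heq]
      exact ⟨h, hh, rfl⟩
    · intro hh
      rw [← heq] at hh
      obtain ⟨y, hy, hyh⟩ := hh
      have : y = h := (MulAut.conj u).injective hyh
      exact this ▸ hy
  have hle : ∀ n, (P : Subgroup G) ≤ M.lowerCentralSeries n := fun n ↦ by
    induction n with
    | zero => exact hPM
    | succ n ih =>
      rw [Subgroup.lowerCentralSeries_succ]
      exact hfoc.trans (Subgroup.commutator_mono ih le_rfl)
  obtain ⟨n, hn⟩ := M.isNilpotent_iff_lowerCentralSeries.mp (hmin M hM.lt_top)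
  exact hPbot (le_bot_iff.mp (hn ▸ hle n))

/-- **Schmidt's theorem**: a finite group all of whose proper subgroups are nilpotent is
solvable. -/
theorem Group.isSolvable_of_forall_isNilpotent {G : Type*} [Group G] [Finite G]
    (hmin : ∀ H : Subgroup G, H < ⊤ → Group.IsNilpotent H) : Group.IsSolvable G := by
  induction hn : Nat.card G using Nat.strong_induction_on generalizing G with
  | _ n ih =>
  subst hn
  rcases subsingleton_or_nontrivial G with _ | _
  · infer_instance
  by_cases hs : ∀ N : Subgroup G, N.Normal → N = ⊥ ∨ N = ⊤
  · have : IsSimpleGroup G := ⟨hs⟩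
    exact IsSimpleGroup.isSolvable_of_forall_isNilpotent hmin
  push Not at hs
  obtain ⟨N, hN, hbot, htop⟩ := hs
  have := hmin N (lt_top_iff_ne_top.mpr htop)
  refine (Group.isSolvable_iff_subgroup_quotient N).mpr ⟨inferInstance, ?_⟩
  refine ih (Nat.card (G ⧸ N)) ?_ (fun H hH ↦ ?_) rfl
  · rw [← N.card_mul_index, ← Subgroup.index]
    exact lt_mul_of_one_lt_left (Nat.pos_of_ne_zero Subgroup.FiniteIndex.index_ne_zero)
      (N.one_lt_card_iff_ne_bot.mpr hbot)
  · have hsurj := QuotientGroup.mk'_surjective N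
    have hlt : H.comap (QuotientGroup.mk' N) < ⊤ := by
      rw [← Subgroup.comap_top (QuotientGroup.mk' N)]
      exact (Subgroup.comap_lt_comap_of_surjective hsurj).mpr hH
    have := hmin _ hlt
    exact Group.nilpotent_of_surjective ((QuotientGroup.mk' N).subgroupComap H)
      ((QuotientGroup.mk' N).subgroupComap_surjective_of_surjective H hsurj)

theorem stmt9 {G : Type*} [Group G] [Finite G]
    (hnn : ¬Group.IsNilpotent G)
    (hmin : ∀ H : Subgroup G, H < ⊤ → Group.IsNilpotent H)
    (q : ℕ) [Fact q.Prime] (S : Sylow q G)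
    (hnorm : ¬(S : Subgroup G).Normal) :
    IsCyclic (S : Subgroup G) := by
  have : Nontrivial G := not_subsingleton_iff_nontrivial.mp fun _ ↦ hnn inferInstance
  have := Group.isSolvable_of_forall_isNilpotent hmin
  have hlt : commutator G < ⊤ := Group.IsSolvable.commutator_lt_top_of_nontrivial G
  have := hmin _ hlt
  have htop : (S : Subgroup G) ⊔ commutator G = ⊤ := by
    by_contra h
    have := hmin _ (lt_top_iff_ne_top.mpr h)
    have : ((S : Subgroup G) ⊔ commutator G).Normal :=
      Subgroup.Normal.of_commutator_le G le_sup_right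
    exact hnorm (S.normal_of_le_of_isNilpotent (M := S ⊔ commutator G) le_sup_left)
  have hmap : (S : Subgroup G).map (QuotientGroup.mk' (commutator G)) = ⊤ := by
    rw [← Subgroup.map_top_of_surjective _ (QuotientGroup.mk'_surjective (commutator G)), ← htop,
      Subgroup.map_sup, QuotientGroup.map_mk'_self, sup_bot_eq]
  have hR : ∀ r : ℕ, r ≠ q → ∀ [Fact r.Prime] (R : Sylow r G), (R : Subgroup G).Normal := by
    intro r hrq _ R
    refine R.normal_of_le_of_isNilpotent (M := commutator G) ?_
    have hdis := IsPGroup.disjoint_of_ne r q hrq _ _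
      (R.isPGroup'.map (QuotientGroup.mk' (commutator G)))
      (S.isPGroup'.map (QuotientGroup.mk' (commutator G)))
    rw [hmap, disjoint_top, Subgroup.map_eq_bot_iff, QuotientGroup.ker_mk'] at hdis
    exact hdis
  by_contra hcyc
  refine hnorm (Subgroup.normalizer_eq_top_iff.mp (Subgroup.index_eq_one.mp ?_))
  by_contra hidx
  obtain ⟨r, hr, hdvd⟩ := Nat.exists_prime_and_dvd hidx
  have : Fact r.Prime := ⟨hr⟩
  obtain ⟨R⟩ : Nonempty (Sylow r G) := inferInstance
  suffices hle : (R : Subgroup G) ≤ Subgroup.normalizer (S : Set G) from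
    R.not_dvd_index (hdvd.trans (Subgroup.index_dvd_of_le hle))
  rcases eq_or_ne r q with rfl | hrq
  · exact absurd (hdvd.trans (Subgroup.index_dvd_of_le Subgroup.le_normalizer)) S.not_dvd_index
  have := hR r hrq R
  refine le_trans (fun y hy ↦ ?_) (Subgroup.centralizer_le_normalizer _)
  rw [Subgroup.mem_centralizer_iff]
  intro x hx
  have hproper : Subgroup.zpowers x ⊔ R < ⊤ := by
    refine lt_top_iff_ne_top.mpr fun h ↦ hcyc ?_
    have hgen : Subgroup.zpowers (QuotientGroup.mk' (R : Subgroup G) x) = ⊤ := by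
      rw [← Subgroup.map_top_of_surjective _ (QuotientGroup.mk'_surjective (R : Subgroup G)), ← h,
        Subgroup.map_sup, QuotientGroup.map_mk'_self, sup_bot_eq, MonoidHom.map_zpowers]
    have : IsCyclic (G ⧸ (R : Subgroup G)) :=
      ⟨_, fun z ↦ Subgroup.mem_zpowers_iff.mp (hgen ▸ Subgroup.mem_top z)⟩
    refine isCyclic_of_injective
      ((QuotientGroup.mk' (R : Subgroup G)).comp (S : Subgroup G).subtype) ?_
    rw [injective_iff_map_eq_one]
    intro s hs
    have hdis := IsPGroup.disjoint_of_ne r q hrq _ _ R.isPGroup' S.isPGroup'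
    exact Subtype.ext (Subgroup.disjoint_def.mp hdis ((QuotientGroup.eq_one_iff _).mp hs) s.2)
  have := hmin _ hproper
  have hxH : x ∈ Subgroup.zpowers x ⊔ R := Subgroup.mem_sup_left (Subgroup.mem_zpowers x)
  have hyH : y ∈ Subgroup.zpowers x ⊔ R := Subgroup.mem_sup_right hy
  have hcom := Group.IsNilpotent.commute_of_isPGroup hrq.symm
    (S.isPGroup'.comap_subtype (K := Subgroup.zpowers x ⊔ R)) R.isPGroup'.comap_subtype
    (a := ⟨x, hxH⟩) (b := ⟨y, hyH⟩) hx hy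
  exact congrArg Subtype.val hcom.eq
end

section
/- Let p be a prime, G a finite group, S a Sylow p-subgroup of G and Q a subgroup of S. Then Q is pronormal in G if and only if Q is weakly closed in S with respect to G, i.e., for every g ∈ G with g⁻¹Qg ≤ S one has g⁻¹Qg = Q. -/
/-- `H` is pronormal in `G` if for each `g ∈ G`, the subgroups `H` and `g⁻¹Hg` are
conjugate by an element of `⟨H, g⁻¹Hg⟩`. -/
def Pronormal {G : Type*} [Group G] (H : Subgroup G) : Prop :=
  ∀ g : G, ∃ x ∈ (H ⊔ subgroupConj g⁻¹ H : Subgroup G),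
    subgroupConj x⁻¹ H = subgroupConj g⁻¹ H

/-- `Q` is weakly closed in `S` with respect to `G`: whenever `g⁻¹Qg ≤ S`, one has
`g⁻¹Qg = Q`. -/
def WeaklyClosed {G : Type*} [Group G] (S Q : Subgroup G) : Prop :=
  ∀ g : G, subgroupConj g⁻¹ Q ≤ S → subgroupConj g⁻¹ Q = Q

theorem mem_subgroupConj {G : Type*} [Group G] {g y : G} {H : Subgroup G} :
    y ∈ subgroupConj g H ↔ g⁻¹ * y * g ∈ H := by
  constructor
  · rintro ⟨z, hz, rfl⟩
    simpa [mul_assoc] using hz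
  · intro h
    exact ⟨g⁻¹ * y * g, h, by simp [mul_assoc]⟩

theorem subgroupConj_mul {G : Type*} [Group G] (g h : G) (H : Subgroup G) :
    subgroupConj (g * h) H = subgroupConj g (subgroupConj h H) := by
  ext y
  simp [mem_subgroupConj, mul_assoc]

theorem subgroupConj_one {G : Type*} [Group G] (H : Subgroup G) :
    subgroupConj 1 H = H := by
  ext y
  simp [mem_subgroupConj]

theorem subgroupConj_mono {G : Type*} [Group G] (g : G) {H K : Subgroup G} (h : H ≤ K) :
    subgroupConj g H ≤ subgroupConj g K :=
  Subgroup.map_mono h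

theorem subgroupConj_le_iff {G : Type*} [Group G] {g : G} {H K : Subgroup G} :
    subgroupConj g H ≤ K ↔ H ≤ subgroupConj g⁻¹ K := by
  constructor <;> intro h
  · simpa [← subgroupConj_mul, subgroupConj_one] using subgroupConj_mono g⁻¹ h
  · simpa [← subgroupConj_mul, subgroupConj_one] using subgroupConj_mono g h

theorem Subgroup.eq_top_of_forall_normal_eq_top {P : Type*} [Group P] [Finite P]
    [Group.IsNilpotent P] {H : Subgroup P}
    (h : ∀ N : Subgroup P, N.Normal → H ≤ N → N = ⊤) : H = ⊤ := by
  rcases eq_top_or_exists_le_coatom H with h' | ⟨M, hM, hHM⟩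
  · exact h'
  · exact absurd (h M (Subgroup.NormalizerCondition.normal_of_coatom M
      Group.normalizerCondition_of_isNilpotent hM) hHM) hM.1

/-- A pronormal subgroup of a finite group has no other conjugate generating with it
a nilpotent subgroup. -/
theorem Pronormal.subgroupConj_eq {G : Type*} [Group G] [Finite G] {Q : Subgroup G}
    (hQ : Pronormal Q) (g : G)
    (hnil : Group.IsNilpotent (Q ⊔ subgroupConj g⁻¹ Q : Subgroup G)) :
    subgroupConj g⁻¹ Q = Q := by
  obtain ⟨x, hx, hxg⟩ := hQ g
  set K := Q ⊔ subgroupConj g⁻¹ Q with hK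
  have htop : Q.subgroupOf K = ⊤ := by
    refine Subgroup.eq_top_of_forall_normal_eq_top fun N hN hQN => ?_
    have hQmap : Q ≤ N.map K.subtype := fun y hy =>
      ⟨⟨y, (le_sup_left : Q ≤ K) hy⟩, hQN (Subgroup.mem_subgroupOf.2 hy), rfl⟩
    have hconj : subgroupConj g⁻¹ Q ≤ N.map K.subtype := by
      rw [← hxg]
      intro y hy
      obtain ⟨n, hn, hny⟩ := hQmap (mem_subgroupConj.1 hy)
      refine ⟨⟨x, hx⟩⁻¹ * n * ⟨x, hx⟩⁻¹⁻¹, hN.conj_mem n hn _, ?_⟩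
      simp only [Subgroup.coe_subtype] at hny
      simp [hny, mul_assoc]
    refine eq_top_iff.2 fun y _ => ?_
    obtain ⟨n, hn, hny⟩ := (sup_le hQmap hconj : K ≤ _) y.2
    rwa [← (Subtype.ext hny : n = y)]
  have hle : subgroupConj g⁻¹ Q ≤ Q := le_sup_right.trans (Subgroup.subgroupOf_eq_top.1 htop)
  refine Subgroup.eq_of_le_of_card_ge hle (le_of_eq ?_)
  exact (Subgroup.card_map_of_injective (MulAut.conj g⁻¹).injective).symm

theorem Sylow.coe_smul_eq_subgroupConj {G : Type*} [Group G] {p : ℕ} (g : G) (S : Sylow p G) :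
    ((g • S : Sylow p G) : Subgroup G) = subgroupConj g S :=
  rfl

/-- Two `p`-subgroups can be moved into a common Sylow `p`-subgroup of the whole group by
conjugating one of them by an element of their join. -/
theorem exists_mem_sup_le_sylow {G : Type*} [Group G] [Finite G] {p : ℕ} [Fact p.Prime]
    {A B : Subgroup G} (hA : IsPGroup p A) (hB : IsPGroup p B) :
    ∃ x ∈ A ⊔ B, ∃ R : Sylow p G, A ≤ R ∧ subgroupConj x⁻¹ B ≤ R := by
  set K := A ⊔ B
  obtain ⟨T, hT⟩ := (hA.comap_subtype (K := K)).exists_le_sylow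
  obtain ⟨T', hT'⟩ := (hB.comap_subtype (K := K)).exists_le_sylow
  obtain ⟨x, rfl⟩ := MulAction.exists_smul_eq K T T'
  obtain ⟨R, hR⟩ := (T.isPGroup'.map K.subtype).exists_le_sylow
  refine ⟨x, x.2, R, fun y hy => hR ⟨⟨y, (le_sup_left : A ≤ K) hy⟩, hT hy, rfl⟩, ?_⟩
  intro y hy
  have hyB : (x : G) * y * (x : G)⁻¹ ∈ B := by simpa using mem_subgroupConj.1 hy
  have hmem := hT' (show (⟨_, (le_sup_right : B ≤ K) hyB⟩ : K) ∈ B.comap K.subtype from hyB)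
  rw [Sylow.coe_smul_eq_subgroupConj, mem_subgroupConj] at hmem
  exact hR ⟨_, hmem, by simp [mul_assoc]⟩

theorem WeaklyClosed.pronormal {G : Type*} [Group G] [Finite G] {p : ℕ} [Fact p.Prime]
    {S : Sylow p G} {Q : Subgroup G} (hQ : Q ≤ (S : Subgroup G))
    (h : WeaklyClosed (S : Subgroup G) Q) : Pronormal Q := by
  intro g
  have hp : IsPGroup p Q := S.isPGroup'.to_le hQ
  obtain ⟨x, hx, R, hQR, hgR⟩ := exists_mem_sup_le_sylow hp
    (hp.map (MulAut.conj g⁻¹).toMonoidHom : IsPGroup p (subgroupConj g⁻¹ Q))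
  obtain ⟨r, rfl⟩ := MulAction.exists_smul_eq G S R
  rw [Sylow.coe_smul_eq_subgroupConj] at hQR hgR
  have hr : subgroupConj r⁻¹ Q = Q := h r (subgroupConj_le_iff.2 (by rwa [inv_inv]))
  have hgxr : subgroupConj (g * x * r)⁻¹ Q = Q := by
    refine h _ ?_
    rw [mul_inv_rev, mul_inv_rev, subgroupConj_mul, subgroupConj_mul]
    exact subgroupConj_le_iff.2 (by rwa [inv_inv])
  refine ⟨x⁻¹, inv_mem hx, ?_⟩
  calc subgroupConj x⁻¹⁻¹ Q = subgroupConj (x * r) (subgroupConj r⁻¹ Q) := by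
        simp [← subgroupConj_mul]
    _ = subgroupConj (x * r) (subgroupConj (g * x * r)⁻¹ Q) := by rw [hr, hgxr]
    _ = subgroupConj g⁻¹ Q := by simp [← subgroupConj_mul, mul_assoc]

theorem stmt10 {G : Type*} [Group G] [Finite G] (p : ℕ) [Fact p.Prime]
    (S : Sylow p G) (Q : Subgroup G) (hQ : Q ≤ (S : Subgroup G)) :
    Pronormal Q ↔ WeaklyClosed (S : Subgroup G) Q := by
  refine ⟨fun h g hg => h.subgroupConj_eq g ?_, WeaklyClosed.pronormal hQ⟩
  exact (S.isPGroup'.to_le (sup_le hQ hg)).isNilpotent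
end

section
/- Let p be a prime, A a finite abelian p-group and G a subgroup of Aut(A). Suppose that the Sylow p-subgroups of G have order p and are not normal in G, and that for each x ∈ G of order p the subgroup [x, A] generated by {x(a)·a⁻¹ : a ∈ A} has order p. Let H = O^{p'}(G) be the smallest normal subgroup of G whose index is prime to p (equivalently, the subgroup generated by all elements of G of p-power order), let A_1 = C_A(H) = {a ∈ A : h(a) = a for all h ∈ H} and A_2 = [H, A] be the subgroup generated by {h(a)·a⁻¹ : h ∈ H, a ∈ A}. Then every element of G maps A_1 onto A_1 and A_2 onto A_2; A is the internal direct product of A_1 and A_2 (A_1 ∩ A_2 = 1 and A_1A_2 = A); and A_2 is isomorphic to C_p × C_p. -/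
/-- For `x : MulAut A`, the subgroup `[x, A]` generated by all `x(a) * a⁻¹`. -/
def autCommutator {A : Type*} [CommGroup A] (x : MulAut A) : Subgroup A :=
  Subgroup.closure {y : A | ∃ a : A, y = x a * a⁻¹}

/-- For `H` a subgroup of a subgroup `G` of `MulAut A`, the fixed points
`C_A(H) = {a ∈ A | h(a) = a for all h ∈ H}`. -/
def fixedSub {A : Type*} [CommGroup A] {G : Subgroup (MulAut A)} (H : Subgroup G) :
    Subgroup A where
  carrier := {a : A | ∀ h : G, h ∈ H → (h : MulAut A) a = a}
  one_mem' := fun h _ => map_one (h : MulAut A)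
  mul_mem' := by
    intro a b ha hb h hh
    rw [map_mul, ha h hh, hb h hh]
  inv_mem' := by
    intro a ha h hh
    rw [map_inv, ha h hh]

/-- For `H` a subgroup of a subgroup `G` of `MulAut A`, the subgroup
`[H, A]` generated by all `h(a) * a⁻¹` with `h ∈ H`, `a ∈ A`. -/
def commSub {A : Type*} [CommGroup A] {G : Subgroup (MulAut A)} (H : Subgroup G) :
    Subgroup A :=
  Subgroup.closure {y : A | ∃ h : G, h ∈ H ∧ ∃ a : A, y = (h : MulAut A) a * a⁻¹}

section Displacement

variable {A : Type*} [CommGroup A]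

/-- The endomorphism `a ↦ x a * a⁻¹` of `A` attached to an automorphism `x`. -/
def displacement (x : MulAut A) : A →* A where
  toFun a := x a * a⁻¹
  map_one' := by simp
  map_mul' a b := by rw [map_mul, mul_inv]; exact mul_mul_mul_comm _ _ _ _

theorem displacement_apply (x : MulAut A) (a : A) : displacement x a = x a * a⁻¹ := rfl

theorem apply_eq_displacement_mul (x : MulAut A) (a : A) : x a = displacement x a * a := by
  simp [displacement_apply]

theorem displacement_eq_one_iff {x : MulAut A} {a : A} : displacement x a = 1 ↔ x a = a := by
  rw [displacement_apply, mul_inv_eq_one]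

theorem autCommutator_eq_range (x : MulAut A) : autCommutator x = (displacement x).range := by
  have h : {y : A | ∃ a : A, y = x a * a⁻¹} = ((displacement x).range : Set A) := by
    ext y
    simp [displacement_apply, eq_comm]
  rw [autCommutator, h, Subgroup.closure_eq]

/-- The automorphisms fixing `C` pointwise and acting trivially modulo `V`. -/
def relStabilizer (C V : Subgroup A) : Subgroup (MulAut A) where
  carrier := {h | C ≤ (displacement h).ker ∧ (displacement h).range ≤ V}
  one_mem' := ⟨fun a _ => by simp [displacement_apply], by
    rintro _ ⟨a, rfl⟩
    simp [displacement_apply]⟩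
  mul_mem' := by
    rintro g h ⟨hg, hg'⟩ ⟨hh, hh'⟩
    refine ⟨fun a ha => ?_, ?_⟩
    · have h1 := displacement_eq_one_iff.1 (hh ha)
      have h2 := displacement_eq_one_iff.1 (hg ha)
      exact displacement_eq_one_iff.2 (by rw [MulAut.mul_apply, h1, h2])
    · rintro _ ⟨a, rfl⟩
      have : displacement (g * h) a = displacement g (h a) * displacement h a := by
        simp [displacement_apply]
      rw [this]
      exact mul_mem (hg' ⟨_, rfl⟩) (hh' ⟨_, rfl⟩)
  inv_mem' := by
    rintro g ⟨hg, hg'⟩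
    refine ⟨fun a ha => ?_, ?_⟩
    · have h2 := displacement_eq_one_iff.1 (hg ha)
      exact displacement_eq_one_iff.2 (by rw [MulAut.inv_apply, MulEquiv.symm_apply_eq, h2])
    · rintro _ ⟨a, rfl⟩
      have : displacement g⁻¹ a = (displacement g (g⁻¹ a))⁻¹ := by
        simp [displacement_apply]
      rw [this]
      exact inv_mem (hg' ⟨_, rfl⟩)

/-- Automorphisms generating the same cyclic group have the same fixed points and the same
displacements. -/
theorem mem_relStabilizer_of_zpowers_eq {x z : MulAut A}
    (h : Subgroup.zpowers x = Subgroup.zpowers z) {C V : Subgroup A}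
    (hx : x ∈ relStabilizer C V) : z ∈ relStabilizer C V := by
  have hz : z ∈ Subgroup.zpowers x := h ▸ Subgroup.mem_zpowers z
  exact (Subgroup.zpowers_le.2 hx) hz

theorem pow_apply_of_displacement_fixed {y : MulAut A} {r : A}
    (h : y (displacement y r) = displacement y r) (i : ℕ) :
    (y ^ i) r = displacement y r ^ i * r := by
  induction i with
  | zero => simp
  | succ i ih =>
    rw [pow_succ', MulAut.mul_apply, ih, map_mul, map_pow, h, pow_succ, mul_assoc,
      ← apply_eq_displacement_mul]

end Displacement

section PrimeOrder

variable {p : ℕ}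

theorem exists_pow_eq_of_card_prime [hp : Fact p.Prime] {A : Type*} [CommGroup A] {R : Subgroup A}
    (hR : Nat.card R = p) {b c : A} (hb : b ∈ R) (hb1 : b ≠ 1) (hc : c ∈ R) :
    ∃ i : ℕ, b ^ i = c := by
  have : Finite R := Nat.finite_of_card_ne_zero (hR ▸ hp.out.ne_zero)
  have hm : (⟨c, hc⟩ : R) ∈ Submonoid.powers (⟨b, hb⟩ : R) :=
    mem_powers_of_prime_card hR (by simpa [Subtype.ext_iff] using hb1)
  obtain ⟨i, hi⟩ := hm
  exact ⟨i, by simpa using congrArg Subtype.val hi⟩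

theorem exists_ne_one_of_card_prime [hp : Fact p.Prime] {A : Type*} [CommGroup A] {R : Subgroup A}
    (hR : Nat.card R = p) : ∃ b ∈ R, b ≠ 1 := by
  refine (R.bot_or_exists_ne_one).resolve_left ?_
  rintro rfl
  rw [Subgroup.card_bot] at hR
  exact hp.out.one_lt.ne hR

theorem inf_eq_bot_of_card_prime [hp : Fact p.Prime] {A : Type*} [CommGroup A] {R K : Subgroup A}
    (hR : Nat.card R = p) (h : ¬ R ≤ K) : R ⊓ K = ⊥ := by
  rw [eq_bot_iff]
  rintro b ⟨hb, hbK⟩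
  by_contra hb1
  refine h fun c hc => ?_
  obtain ⟨i, rfl⟩ := exists_pow_eq_of_card_prime hR hb hb1 hc
  exact pow_mem hbK i

/-- An automorphism of order `p` whose displacements form a group of order `p` fixes them. -/
theorem range_displacement_le_ker [hp : Fact p.Prime] {A : Type*} [CommGroup A] {x : MulAut A}
    (hx : x ^ p = 1) (hR : Nat.card (displacement x).range = p) :
    (displacement x).range ≤ (displacement x).ker := by
  intro b hb
  by_cases hb1 : b = 1
  · rw [hb1]; exact one_mem _
  obtain ⟨k, hk⟩ := exists_pow_eq_of_card_prime hR hb hb1 (c := x b)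
    (by rw [apply_eq_displacement_mul]; exact mul_mem ⟨b, rfl⟩ hb)
  have hiter : ∀ n : ℕ, (x ^ n) b = b ^ k ^ n := by
    intro n
    induction n with
    | zero => simp
    | succ n ih => rw [pow_succ', MulAut.mul_apply, ih, map_pow, ← hk, ← pow_mul, pow_succ']
  have horder : orderOf b = p := by
    refine orderOf_eq_prime ?_ hb1
    have : (⟨b, hb⟩ : (displacement x).range) ^ p = 1 := hR ▸ pow_card_eq_one'
    simpa using congrArg Subtype.val this
  have h1 : b ^ k ^ p = b ^ 1 := by rw [← hiter, hx]; simp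
  rw [pow_eq_pow_iff_modEq, horder, ← ZMod.natCast_eq_natCast_iff] at h1
  push_cast at h1
  rw [ZMod.pow_card] at h1
  refine displacement_eq_one_iff.2 ?_
  rw [← hk]
  conv_rhs => rw [← pow_one b]
  rw [pow_eq_pow_iff_modEq, horder, ← ZMod.natCast_eq_natCast_iff]
  simpa using h1

variable {Γ : Type*} [Group Γ]

/-- If the Sylow `p`-subgroups have order `p`, elements of order `p` that commute generate the same
subgroup. -/
theorem zpowers_eq_of_commute [Finite Γ] (hS : ∀ P : Sylow p Γ, Nat.card P = p) {x z : Γ}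
    (hx : orderOf x = p) (hz : orderOf z = p) (hxz : Commute x z) :
    Subgroup.zpowers x = Subgroup.zpowers z := by
  have hpx : IsPGroup p (Subgroup.zpowers x) :=
    IsPGroup.of_card (n := 1) (by rw [Nat.card_zpowers, hx, pow_one])
  have hpz : IsPGroup p (Subgroup.zpowers z) :=
    IsPGroup.of_card (n := 1) (by rw [Nat.card_zpowers, hz, pow_one])
  have hle : Subgroup.zpowers z ≤ Subgroup.normalizer (Subgroup.zpowers x : Set Γ) := by
    refine le_trans ?_ (Subgroup.centralizer_le_normalizer _)
    rw [Subgroup.zpowers_le, Subgroup.mem_centralizer_iff]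
    rintro _ ⟨n, rfl⟩
    exact (hxz.zpow_left n).eq
  obtain ⟨P, hP⟩ := (hpx.to_sup_of_normal_left' hpz hle).exists_le_sylow
  have key : ∀ w : Γ, orderOf w = p → w ∈ P → Subgroup.zpowers w = P := fun w hw hwP =>
    Subgroup.eq_of_le_of_card_ge (Subgroup.zpowers_le.2 hwP)
      (by rw [Nat.card_zpowers, hw]; exact (hS P).le)
  rw [key x hx (hP (Subgroup.mem_sup_left (Subgroup.mem_zpowers x))),
    key z hz (hP (Subgroup.mem_sup_right (Subgroup.mem_zpowers z)))]

theorem mem_of_orderOf_eq_of_not_dvd_index [hp : Fact p.Prime] {H : Subgroup Γ} [H.Normal]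
    (hH : ¬ p ∣ H.index) {x : Γ} (hx : orderOf x = p) : x ∈ H := by
  rw [← QuotientGroup.eq_one_iff, ← orderOf_eq_one_iff]
  have h1 : orderOf (x : Γ ⧸ H) ∣ p := hx ▸ orderOf_map_dvd (QuotientGroup.mk' H) x
  refine ((Nat.dvd_prime hp.out).1 h1).resolve_right fun h => hH ?_
  rw [← h]
  exact orderOf_dvd_natCard _

theorem orderOf_eq_of_mem_sylow [hp : Fact p.Prime] (hS : ∀ P : Sylow p Γ, Nat.card P = p)
    {P : Sylow p Γ} {x : Γ} (hx : x ∈ P) (hx1 : x ≠ 1) : orderOf x = p := by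
  refine ((Nat.dvd_prime hp.out).1 ?_).resolve_left (mt orderOf_eq_one_iff.1 hx1)
  rw [← hS P]
  exact Subgroup.orderOf_dvd_natCard _ hx

/-- If the Sylow `p`-subgroups have order `p`, the smallest normal subgroup of index prime to `p`
lies in every subgroup containing all elements of order `p`. -/
theorem le_of_forall_orderOf_eq_mem [Finite Γ] [Fact p.Prime]
    (hS : ∀ P : Sylow p Γ, Nat.card P = p) {H N : Subgroup Γ}
    (hHmin : ∀ K : Subgroup Γ, K.Normal → ¬p ∣ K.index → H ≤ K)
    (hN : ∀ x : Γ, orderOf x = p → x ∈ N) : H ≤ N := by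
  have hind : ¬ p ∣ (Subgroup.normalClosure {x : Γ | orderOf x = p}).index := by
    obtain ⟨P⟩ : Nonempty (Sylow p Γ) := inferInstance
    have hle : (P : Subgroup Γ) ≤ Subgroup.normalClosure {x : Γ | orderOf x = p} := by
      intro x hx
      by_cases hx1 : x = 1
      · rw [hx1]; exact one_mem _
      · exact Subgroup.subset_normalClosure (orderOf_eq_of_mem_sylow hS hx hx1)
    exact fun h => P.not_dvd_index (h.trans (Subgroup.index_dvd_of_le hle))
  refine (hHmin _ Subgroup.normalClosure_normal hind).trans ((Subgroup.closure_le _).2 ?_)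
  intro y hy
  obtain ⟨x, hx, hxy⟩ := Group.mem_conjugatesOfSet_iff.1 hy
  obtain ⟨g, rfl⟩ := isConj_iff.1 hxy
  exact hN _ (by rw [← MulAut.conj_apply, MulEquiv.orderOf_eq]; exact hx)

theorem exists_orderOf_eq_zpowers_ne [Fact p.Prime] (hS : ∀ P : Sylow p Γ, Nat.card P = p)
    (hN : ∀ P : Sylow p Γ, ¬(P : Subgroup Γ).Normal) :
    ∃ x y : Γ, orderOf x = p ∧ orderOf y = p ∧ Subgroup.zpowers x ≠ Subgroup.zpowers y := by
  obtain ⟨P⟩ : Nonempty (Sylow p Γ) := inferInstance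
  obtain ⟨x, hx, g, hg⟩ : ∃ x ∈ P, ∃ g : Γ, g * x * g⁻¹ ∉ P := by
    by_contra! h
    exact hN P ⟨h⟩
  have hx1 : x ≠ 1 := by
    rintro rfl
    exact hg (by simp)
  have hxp := orderOf_eq_of_mem_sylow hS hx hx1
  refine ⟨x, g * x * g⁻¹, hxp, ?_, fun h => hg ?_⟩
  · rw [← MulAut.conj_apply, MulEquiv.orderOf_eq, hxp]
  · exact (Subgroup.zpowers_le.2 hx : _ ≤ (P : Subgroup Γ)) (h ▸ Subgroup.mem_zpowers _)

end PrimeOrder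

section Decomposition

variable {A : Type*} [CommGroup A] {p : ℕ} [hp : Fact p.Prime]

/-- If the displacements of `z` are fixed by `x`, then `x` and `z` generate the same subgroup. -/
theorem zpowers_eq_of_range_le_ker [Finite A] {G : Subgroup (MulAut A)}
    (hS : ∀ P : Sylow p G, Nat.card P = p)
    (hcard : ∀ x : G, orderOf x = p → Nat.card (displacement (x : MulAut A)).range = p)
    {x z : G} (hx : orderOf x = p) (hz : orderOf z = p)
    (h : (displacement (z : MulAut A)).range ≤ (displacement (x : MulAut A)).ker) :
    Subgroup.zpowers x = Subgroup.zpowers z := by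
  have fixes : ∀ w : G, orderOf w = p → ∀ a : A,
      (w : MulAut A) (displacement (w : MulAut A) a) = displacement (w : MulAut A) a := by
    intro w hw a
    refine displacement_eq_one_iff.1 (range_displacement_le_ker (p := p) ?_ (hcard w hw) ⟨a, rfl⟩)
    rw [← Subgroup.coe_pow, ← hw, pow_orderOf_eq_one, Subgroup.coe_one]
  have hfx := fixes x hx
  have hfz := fixes z hz
  have hxz : ∀ a, (x : MulAut A) (displacement (z : MulAut A) a) = displacement (z : MulAut A) a :=
    fun a => displacement_eq_one_iff.1 (h ⟨a, rfl⟩)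
  set X := displacement (x : MulAut A)
  set Z := displacement (z : MulAut A)
  have hXa : ∀ a, (x : MulAut A) a = X a * a := apply_eq_displacement_mul _
  have hZa : ∀ a, (z : MulAut A) a = Z a * a := apply_eq_displacement_mul _
  have hZZ : ∀ a, Z (Z a) = 1 := fun a => displacement_eq_one_iff.2 (hfz a)
  have hXX : ∀ a, X (X a) = 1 := fun a => displacement_eq_one_iff.2 (hfx a)
  have hXZ : ∀ a, X (Z a) = 1 := fun a => displacement_eq_one_iff.2 (hxz a)
  obtain ⟨c, hc⟩ : ∃ c : G, z * x = x * z * c := ⟨(x * z)⁻¹ * (z * x), by group⟩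
  have hca : ∀ a, (c : MulAut A) a = Z (X a) * a := by
    intro a
    apply ((x : MulAut A) * (z : MulAut A)).injective
    have := congrArg (fun g : G => (g : MulAut A) a) hc
    simp only [Subgroup.coe_mul, MulAut.mul_apply] at this ⊢
    rw [← this]
    simp only [hXa, hZa, map_mul, hZZ, hXZ, one_mul]
    simp only [mul_assoc, mul_left_comm (X a)]
    rw [mul_left_comm]
  have hcx : Commute c x := by
    refine Subtype.ext (MulEquiv.ext fun a => ?_)
    simp only [Subgroup.coe_mul, MulAut.mul_apply, hca, hXa, map_mul, hXX, hXZ, one_mul]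
    rw [mul_left_comm]
  have hcz : Commute c z := by
    refine Subtype.ext (MulEquiv.ext fun a => ?_)
    simp only [Subgroup.coe_mul, MulAut.mul_apply, hca, hZa, map_mul, hZZ, hXZ, one_mul]
    rw [mul_left_comm]
  by_cases hc1 : c = 1
  · refine zpowers_eq_of_commute hS hx hz ?_
    rw [hc1, mul_one] at hc
    exact hc.symm
  · have hcp : orderOf c = p := by
      refine orderOf_eq_prime (Subtype.ext (MulEquiv.ext fun a => ?_)) hc1
      have hdc : displacement (c : MulAut A) a = Z (X a) := by
        rw [displacement_apply, hca, mul_inv_cancel_right]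
      have hZp : Z (X a) ^ p = 1 := by
        have : (⟨Z (X a), X a, rfl⟩ : Z.range) ^ p = 1 := hcard z hz ▸ pow_card_eq_one'
        simpa using congrArg Subtype.val this
      rw [Subgroup.coe_pow, pow_apply_of_displacement_fixed, hdc, hZp]
      · simp
      · rw [hdc, hca, hXZ, map_one, one_mul]
    rw [← zpowers_eq_of_commute hS hcp hx hcx, zpowers_eq_of_commute hS hcp hz hcz]

theorem exists_mem_displacement_eq [Finite A] {x : MulAut A} {R : Subgroup A}
    (hx : Nat.card (displacement x).range = p) (hR : Nat.card R = p)
    (h : R ⊓ (displacement x).ker = ⊥) (a : A) :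
    ∃ s ∈ R, displacement x s = displacement x a := by
  obtain ⟨b, hb, hb1⟩ := exists_ne_one_of_card_prime hR
  have hxb : displacement x b ≠ 1 := fun h1 =>
    hb1 (Subgroup.mem_bot.1 (h ▸ (⟨hb, h1⟩ : b ∈ R ⊓ (displacement x).ker)))
  obtain ⟨i, hi⟩ := exists_pow_eq_of_card_prime hx ⟨_, rfl⟩ hxb ⟨a, rfl⟩
  exact ⟨b ^ i, pow_mem hb i, by rw [map_pow, hi]⟩

theorem nonempty_sup_mulEquiv {R S : Subgroup A} (hR : Nat.card R = p) (hS : Nat.card S = p)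
    (h : R ⊓ S = ⊥) :
    Nonempty ((R ⊔ S : Subgroup A) ≃* (Multiplicative (ZMod p) × Multiplicative (ZMod p))) := by
  have hinj : Function.Injective (R.subtype.coprod S.subtype) := by
    rw [injective_iff_map_eq_one]
    rintro ⟨r, s⟩ hrs
    have hrs' : (r : A) * s = 1 := by simpa using hrs
    have hr : (r : A) ∈ R ⊓ S := ⟨r.2, by
      rw [eq_inv_of_mul_eq_one_left hrs']
      exact S.inv_mem s.2⟩
    rw [h, Subgroup.mem_bot] at hr
    rw [hr, one_mul] at hrs'
    exact Prod.ext (Subtype.ext hr) (Subtype.ext hrs')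
  have hrange : (R.subtype.coprod S.subtype).range = R ⊔ S := by
    ext a
    simp [Subgroup.mem_sup, MonoidHom.mem_range]
  have hZ : Nat.card (Multiplicative (ZMod p)) = p := by simp
  have eR : R ≃* Multiplicative (ZMod p) := mulEquivOfPrimeCardEq hR hZ
  have eS : S ≃* Multiplicative (ZMod p) := mulEquivOfPrimeCardEq hS hZ
  exact ⟨((MulEquiv.subgroupCongr hrange).symm.trans
    (MonoidHom.ofInjective hinj).symm).trans (eR.prodCongr eS)⟩

/-- Every element of order `p` acts as the transvections `x` and `y` do: it fixes their common
fixed points and its displacements lie in the sum of theirs. -/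
theorem mem_relStabilizer_of_orderOf_eq [Finite A] {G : Subgroup (MulAut A)}
    (hS : ∀ P : Sylow p G, Nat.card P = p)
    (hcard : ∀ x : G, orderOf x = p → Nat.card (displacement (x : MulAut A)).range = p)
    {x y : G} (hx : orderOf x = p) (hy : orderOf y = p) {C V : Subgroup A}
    (hV : V = (displacement (x : MulAut A)).range ⊔ (displacement (y : MulAut A)).range)
    (hVC : V ⊔ C = ⊤)
    (hxN : (x : MulAut A) ∈ relStabilizer C V) (hyN : (y : MulAut A) ∈ relStabilizer C V)
    (hxx : (displacement (x : MulAut A)).range ≤ (displacement (x : MulAut A)).ker)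
    (hyy : (displacement (y : MulAut A)).range ≤ (displacement (y : MulAut A)).ker)
    (hxy : (displacement (x : MulAut A)).range ⊓ (displacement (y : MulAut A)).ker = ⊥)
    {z : G} (hz : orderOf z = p) : (z : MulAut A) ∈ relStabilizer C V := by
  suffices H : ∀ v ∈ V, ∃ t : G, orderOf t = p ∧ (t : MulAut A) ∈ relStabilizer C V ∧
      (t : MulAut A) v = v by
    obtain ⟨w, hw, hw1⟩ := exists_ne_one_of_card_prime (hcard z hz)
    obtain ⟨v, hv, c, hc, hvc⟩ := Subgroup.mem_sup.1 (hVC ▸ Subgroup.mem_top w)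
    obtain ⟨t, ht, htN, htv⟩ := H v hv
    have hle : (displacement (z : MulAut A)).range ≤ (displacement (t : MulAut A)).ker := by
      intro b hb
      obtain ⟨i, rfl⟩ := exists_pow_eq_of_card_prime (hcard z hz) hw hw1 hb
      refine pow_mem ?_ i
      rw [← hvc]
      exact mul_mem (displacement_eq_one_iff.2 htv) (htN.1 hc)
    have heq := zpowers_eq_of_range_le_ker hS hcard ht hz hle
    refine mem_relStabilizer_of_zpowers_eq (x := (t : MulAut A)) ?_ htN
    have := congrArg (Subgroup.map G.subtype) heq
    simpa only [MonoidHom.map_zpowers, Subgroup.subtype_apply] using this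
  intro v hv
  rw [hV] at hv
  obtain ⟨r, hr, s, hs, rfl⟩ := Subgroup.mem_sup.1 hv
  by_cases hr1 : r = 1
  · exact ⟨y, hy, hyN, by rw [hr1, one_mul]; exact displacement_eq_one_iff.1 (hyy hs)⟩
  have hyr : displacement (y : MulAut A) r ≠ 1 := fun h1 =>
    hr1 (Subgroup.mem_bot.1 (hxy ▸ (⟨hr, h1⟩ : r ∈ (displacement (x : MulAut A)).range ⊓
      (displacement (y : MulAut A)).ker)))
  obtain ⟨i, hi⟩ := exists_pow_eq_of_card_prime (hcard y hy) ⟨r, rfl⟩ hyr hs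
  have hyi : ((y : MulAut A) ^ i) r = r * s := by
    rw [pow_apply_of_displacement_fixed (displacement_eq_one_iff.1 (hyy ⟨r, rfl⟩)), hi, mul_comm]
  refine ⟨y ^ i * x * (y ^ i)⁻¹, ?_, ?_, ?_⟩
  · rw [← MulAut.conj_apply, MulEquiv.orderOf_eq, hx]
  · simp only [Subgroup.coe_mul, Subgroup.coe_inv, Subgroup.coe_pow]
    exact mul_mem (mul_mem (pow_mem hyN i) hxN) (inv_mem (pow_mem hyN i))
  · simp only [Subgroup.coe_mul, Subgroup.coe_inv, Subgroup.coe_pow]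
    rw [← hyi, MulAut.mul_apply, MulAut.mul_apply, MulAut.inv_apply_self,
      displacement_eq_one_iff.1 (hxx hr)]

theorem map_eq_of_forall_map_le {G : Subgroup (MulAut A)} {F : Subgroup A}
    (h : ∀ g : G, ∀ a ∈ F, (g : MulAut A) a ∈ F) (g : G) :
    Subgroup.map ((g : MulAut A) : A ≃* A).toMonoidHom F = F := by
  apply le_antisymm
  · rintro _ ⟨a, ha, rfl⟩
    exact h g a ha
  · intro a ha
    exact ⟨((g⁻¹ : G) : MulAut A) a, h g⁻¹ a ha, MulAut.apply_inv_self _ (g : MulAut A) a⟩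

theorem apply_mem_fixedSub {G : Subgroup (MulAut A)} {H : Subgroup G} (hH : H.Normal) (g : G)
    {a : A} (ha : a ∈ fixedSub H) : (g : MulAut A) a ∈ fixedSub H := by
  intro h hh
  have h1 := ha _ (hH.conj_mem h hh g⁻¹)
  have h2 := congrArg (g : MulAut A) h1
  simpa using h2

theorem apply_mem_commSub {G : Subgroup (MulAut A)} {H : Subgroup G} (hH : H.Normal) (g : G)
    {a : A} (ha : a ∈ commSub H) : (g : MulAut A) a ∈ commSub H := by
  suffices commSub H ≤ (commSub H).comap ((g : MulAut A) : A ≃* A).toMonoidHom from this ha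
  refine (Subgroup.closure_le _).2 ?_
  rintro _ ⟨h, hh, b, rfl⟩
  refine Subgroup.subset_closure ⟨_, hH.conj_mem h hh g, (g : MulAut A) b, ?_⟩
  simp

end Decomposition

theorem stmt12 (p : ℕ) [Fact p.Prime] {A : Type*} [CommGroup A] [Finite A]
    (hA : IsPGroup p A) (G : Subgroup (MulAut A))
    (hSylCard : ∀ P : Sylow p G, Nat.card P = p)
    (hSylNotNorm : ∀ P : Sylow p G, ¬(P : Subgroup G).Normal)
    (hcomm : ∀ x : MulAut A, x ∈ G → orderOf x = p → Nat.card (autCommutator x) = p)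
    (H : Subgroup G) (hHnorm : H.Normal) (hHind : ¬p ∣ H.index)
    (hHmin : ∀ K : Subgroup G, K.Normal → ¬p ∣ K.index → H ≤ K) :
    (∀ g : G, Subgroup.map ((g : MulAut A) : A ≃* A).toMonoidHom (fixedSub H) = fixedSub H ∧
        Subgroup.map ((g : MulAut A) : A ≃* A).toMonoidHom (commSub H) = commSub H) ∧
      fixedSub H ⊓ commSub H = ⊥ ∧ fixedSub H ⊔ commSub H = ⊤ ∧
      Nonempty (commSub H ≃* (Multiplicative (ZMod p) × Multiplicative (ZMod p))) := by
  have hcard : ∀ x : G, orderOf x = p → Nat.card (displacement (x : MulAut A)).range = p := by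
    intro x hx
    rw [← autCommutator_eq_range]
    exact hcomm x x.2 (by rw [Subgroup.orderOf_coe, hx])
  have hker : ∀ x : G, orderOf x = p →
      (displacement (x : MulAut A)).range ≤ (displacement (x : MulAut A)).ker := by
    intro x hx
    refine range_displacement_le_ker (p := p) ?_ (hcard x hx)
    rw [← Subgroup.coe_pow, ← hx, pow_orderOf_eq_one, Subgroup.coe_one]
  obtain ⟨x, y, hx, hy, hne⟩ := exists_orderOf_eq_zpowers_ne hSylCard hSylNotNorm
  have hyx := inf_eq_bot_of_card_prime (hcard y hy)
    fun h => hne (zpowers_eq_of_range_le_ker hSylCard hcard hx hy h)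
  have hxy := inf_eq_bot_of_card_prime (hcard x hx)
    fun h => hne (zpowers_eq_of_range_le_ker hSylCard hcard hy hx h).symm
  obtain ⟨V, hV⟩ : ∃ V, V = (displacement (x : MulAut A)).range ⊔
    (displacement (y : MulAut A)).range := ⟨_, rfl⟩
  obtain ⟨C, hC⟩ : ∃ C, C = (displacement (x : MulAut A)).ker ⊓
    (displacement (y : MulAut A)).ker := ⟨_, rfl⟩
  have hinf : C ⊓ V = ⊥ := by
    rw [eq_bot_iff]
    rintro v ⟨hvC, hv⟩
    rw [SetLike.mem_coe, hC] at hvC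
    rw [SetLike.mem_coe, hV] at hv
    obtain ⟨r, hr, s, hs, rfl⟩ := Subgroup.mem_sup.1 hv
    have hs' := (Subgroup.mul_mem_cancel_left _ (hker x hx hr)).1 hvC.1
    have hr' := (Subgroup.mul_mem_cancel_right _ (hker y hy hs)).1 hvC.2
    exact mul_mem (hxy.le ⟨hr, hr'⟩) (hyx.le ⟨hs, hs'⟩)
  have hsup : V ⊔ C = ⊤ := by
    rw [eq_top_iff]
    intro a _
    obtain ⟨s, hs, hsa⟩ := exists_mem_displacement_eq (hcard x hx) (hcard y hy) hyx a
    obtain ⟨r, hr, hra⟩ := exists_mem_displacement_eq (hcard y hy) (hcard x hx) hxy a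
    have hr1 : displacement (x : MulAut A) r = 1 := hker x hx hr
    have hs1 : displacement (y : MulAut A) s = 1 := hker y hy hs
    refine Subgroup.mem_sup.2 ⟨r * s, ?_, (r * s)⁻¹ * a, ?_, mul_inv_cancel_left _ _⟩
    · rw [hV]
      exact Subgroup.mul_mem_sup hr hs
    · rw [hC]
      constructor <;> simp [hr1, hs1, hsa, hra]
  have hxN : (x : MulAut A) ∈ relStabilizer C V := ⟨hC ▸ inf_le_left, hV ▸ le_sup_left⟩
  have hyN : (y : MulAut A) ∈ relStabilizer C V := ⟨hC ▸ inf_le_right, hV ▸ le_sup_right⟩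
  have hHN : H ≤ (relStabilizer C V).subgroupOf G :=
    le_of_forall_orderOf_eq_mem hSylCard hHmin fun z hz =>
      mem_relStabilizer_of_orderOf_eq hSylCard hcard hx hy hV hsup hxN hyN (hker x hx)
        (hker y hy) hxy hz
  have hxH : x ∈ H := mem_of_orderOf_eq_of_not_dvd_index hHind hx
  have hyH : y ∈ H := mem_of_orderOf_eq_of_not_dvd_index hHind hy
  have hfix : fixedSub H = C := by
    apply le_antisymm
    · intro a ha
      rw [hC]
      exact ⟨displacement_eq_one_iff.2 (ha x hxH), displacement_eq_one_iff.2 (ha y hyH)⟩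
    · intro a ha h hh
      exact displacement_eq_one_iff.1 ((hHN hh).1 ha)
  have hcommSub : commSub H = V := by
    apply le_antisymm
    · refine (Subgroup.closure_le _).2 ?_
      rintro _ ⟨h, hh, a, rfl⟩
      exact (hHN hh).2 ⟨a, rfl⟩
    · rw [hV, sup_le_iff]
      constructor
      · rintro _ ⟨a, rfl⟩
        exact Subgroup.subset_closure ⟨x, hxH, a, rfl⟩
      · rintro _ ⟨a, rfl⟩
        exact Subgroup.subset_closure ⟨y, hyH, a, rfl⟩
  refine ⟨fun g => ⟨map_eq_of_forall_map_le (fun g a ha => apply_mem_fixedSub hHnorm g ha) g,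
    map_eq_of_forall_map_le (fun g a ha => apply_mem_commSub hHnorm g ha) g⟩, ?_, ?_, ?_⟩
  · rw [hfix, hcommSub, hinf]
  · rw [hfix, hcommSub, sup_comm, hsup]
  · rw [hcommSub, hV]
    refine nonempty_sup_mulEquiv (hcard x hx) (hcard y hy) ?_
    rw [eq_bot_iff, ← hxy]
    exact inf_le_inf_left _ (hker y hy)
end

section
/- Let p be a prime and G a finite group that is not p-closed but all of whose proper subgroups are p-closed. Then either G is minimal nonnilpotent (G is not nilpotent but every proper subgroup of G is nilpotent), or the quotient G/Φ(G) of G by its Frattini subgroup is a nonabelian simple group. -/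
/-- A finite group is `p`-closed if it has a normal Sylow `p`-subgroup. -/
def PClosed (p : ℕ) (G : Type*) [Group G] : Prop :=
  ∃ P : Sylow p G, (P : Subgroup G).Normal

open Subgroup

section

variable {p : ℕ} [Fact p.Prime] {G : Type*} [Group G] [Finite G]

theorem PClosed.le_normalizer {H : Subgroup G} (hH : PClosed p H) (P : Sylow p G)
    (hP : (P : Subgroup G) ≤ H) : H ≤ normalizer (P : Set G) := by
  obtain ⟨S, hS⟩ := hH
  have := Sylow.unique_of_normal S hS
  have hPS : P.subtype hP = S := Subsingleton.elim _ _
  rw [← hPS, Sylow.coe_subtype] at hS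
  exact (normal_subgroupOf_iff_le_normalizer hP).mp hS

theorem PClosed.normal {P : Sylow p G} (hG : PClosed p G) : (P : Subgroup G).Normal := by
  obtain ⟨S, hS⟩ := hG
  have := Sylow.unique_of_normal S hS
  rwa [Subsingleton.elim P S]

theorem mk'_comp_subtype_surjective {G : Type*} [Group G] {N M : Subgroup G} [N.Normal]
    (h : N ⊔ M = ⊤) : Function.Surjective ((QuotientGroup.mk' N).comp M.subtype) := by
  rw [← MonoidHom.range_eq_top, MonoidHom.range_comp, range_subtype,
    ← map_top_of_surjective _ (QuotientGroup.mk'_surjective N), ← h, Subgroup.map_sup,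
    (Subgroup.map_eq_bot_iff N).mpr (QuotientGroup.ker_mk' N).ge, bot_sup_eq]

theorem isPGroup_quotient_of_sup_eq_top {p : ℕ} {G : Type*} [Group G] {N P : Subgroup G}
    [N.Normal] (hP : IsPGroup p P) (h : N ⊔ P = ⊤) : IsPGroup p (G ⧸ N) :=
  hP.of_surjective _ (mk'_comp_subtype_surjective h)

theorem le_of_isPGroup_quotient {q : ℕ} [Fact q.Prime] {G : Type*} [Group G] (hqp : q ≠ p)
    {N X : Subgroup G} [N.Normal] (hN : IsPGroup p (G ⧸ N)) (hX : IsPGroup q X) : X ≤ N := by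
  have hd := IsPGroup.disjoint_of_ne q p hqp (X.map (QuotientGroup.mk' N)) ⊤ (hX.map _)
    (hN.to_subgroup _)
  rw [disjoint_top, Subgroup.map_eq_bot_iff, QuotientGroup.ker_mk'] at hd
  exact hd

/-- If `G = N M` with `N` normal and both factors `p`-closed, then `M` normalizes the product of
the Sylow `p`-subgroups of the factors, which is a Sylow `p`-subgroup of `G`. -/
theorem exists_sylow_le_normalizer {N M : Subgroup G} [N.Normal] (h : N ⊔ M = ⊤)
    (hN : PClosed p N) (hM : PClosed p M) :
    ∃ P : Sylow p G, M ≤ normalizer (P : Set G) := by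
  obtain ⟨S, hS⟩ := hN
  obtain ⟨T, hT⟩ := hM
  have := Sylow.characteristic_of_normal S hS
  have hQ : ((S : Subgroup N).map N.subtype).Normal := inferInstance
  obtain ⟨P, hP⟩ := (T.isPGroup'.map M.subtype).exists_le_sylow
  have hQP := (S.isPGroup'.map N.subtype).le_sylow_of_normal P
  have hsurj := mk'_comp_subtype_surjective h
  have hPN : ((P : Subgroup G).subgroupOf N) = S :=
    S.is_maximal' P.isPGroup'.comap_subtype (map_le_iff_le_comap.mp hQP)
  have hPT : (P : Subgroup G).map (QuotientGroup.mk' N) = T.mapSurjective hsurj := by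
    refine (T.mapSurjective hsurj).is_maximal' (P.isPGroup'.map _) ?_
    rw [Sylow.coe_mapSurjective, ← map_map]
    exact map_mono hP
  refine ⟨P, le_normalizer_iff.mpr fun m hm x hx ↦ ?_⟩
  have hx' : QuotientGroup.mk' N x ∈ (P : Subgroup G).map (QuotientGroup.mk' N) :=
    mem_map_of_mem _ hx
  rw [hPT, Sylow.coe_mapSurjective] at hx'
  obtain ⟨t, ht, htx⟩ := hx'
  have htP : (t : G) ∈ P := hP (mem_map_of_mem _ ht)
  have htN : (t : G)⁻¹ * x ∈ N := QuotientGroup.eq.mp htx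
  have hy : (t : G)⁻¹ * x ∈ (S : Subgroup N).map N.subtype :=
    ⟨⟨_, htN⟩, hPN ▸ mem_subgroupOf.mpr (mul_mem (inv_mem htP) hx), rfl⟩
  have h1 : m * t * m⁻¹ ∈ P := hP ⟨⟨m, hm⟩ * t * ⟨m, hm⟩⁻¹, hT.conj_mem _ ht _, rfl⟩
  have h2 := hQP (hQ.conj_mem _ hy m)
  have h3 : m * x * m⁻¹ = (m * t * m⁻¹) * (m * ((t : G)⁻¹ * x) * m⁻¹) := by group
  rw [h3]
  exact mul_mem h1 h2

theorem exists_sup_sylow_eq_top (hG : ¬PClosed p G)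
    (hprop : ∀ H : Subgroup G, H < ⊤ → PClosed p H) {N M : Subgroup G} [N.Normal]
    (hN : N < ⊤) (hM : M < ⊤) (h : N ⊔ M = ⊤) :
    ∃ P : Sylow p G, N ⊔ (P : Subgroup G) = ⊤ := by
  obtain ⟨P, hP⟩ := exists_sylow_le_normalizer h (hprop N hN) (hprop M hM)
  refine ⟨P, not_lt_top_iff.mp fun hlt ↦ hG ⟨P, normalizer_eq_top_iff.mp ?_⟩⟩
  have hNP := (hprop _ hlt).le_normalizer P le_sup_right
  exact top_le_iff.mp (h ▸ sup_le (le_sup_left.trans hNP) hP)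

/-- A prime divisor `q` of the number of Sylow `p`-subgroups witnesses the failure of
`p`-closedness: no Sylow `q`-subgroup normalizes a Sylow `p`-subgroup. -/
theorem exists_prime_forall_sylow_not_le_normalizer (hG : ¬PClosed p G) :
    ∃ q : ℕ, q.Prime ∧ q ≠ p ∧ ∀ (R : Sylow q G) (P : Sylow p G),
      ¬(R : Subgroup G) ≤ normalizer (P : Set G) := by
  have hcard : Nat.card (Sylow p G) ≠ 1 := fun h ↦ by
    obtain ⟨P⟩ : Nonempty (Sylow p G) := inferInstance
    exact hG ⟨P, normalizer_eq_top_iff.mp (index_eq_one.mp (P.card_eq_index_normalizer ▸ h))⟩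
  obtain ⟨q, hq, hdvd⟩ := Nat.exists_prime_and_dvd hcard
  have : Fact q.Prime := ⟨hq⟩
  refine ⟨q, hq, ?_, fun R P hle ↦ R.not_dvd_index ?_⟩
  · rintro rfl
    exact not_dvd_card_sylow q G hdvd
  · exact (P.card_eq_index_normalizer ▸ hdvd).trans (index_dvd_of_le hle)

theorem exists_normal_sylow_sup_eq_top (hG : ¬PClosed p G)
    (hprop : ∀ H : Subgroup G, H < ⊤ → PClosed p H) {N : Subgroup G} [N.Normal]
    (hN : N < ⊤) {P : Sylow p G} (h : N ⊔ (P : Subgroup G) = ⊤) :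
    ∃ q : ℕ, q.Prime ∧ q ≠ p ∧ ∃ R : Sylow q G, (R : Subgroup G).Normal ∧
      (R : Subgroup G) ⊔ (P : Subgroup G) = ⊤ := by
  obtain ⟨q, hq, hqp, hR⟩ := exists_prime_forall_sylow_not_le_normalizer hG
  have : Fact q.Prime := ⟨hq⟩
  obtain ⟨R⟩ : Nonempty (Sylow q G) := inferInstance
  refine ⟨q, hq, hqp, R, ?_, not_lt_top_iff.mp fun hlt ↦
    hR R P (le_sup_left.trans ((hprop _ hlt).le_normalizer P le_sup_right))⟩
  have hRN : (R : Subgroup G) ≤ N :=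
    le_of_isPGroup_quotient hqp (isPGroup_quotient_of_sup_eq_top P.isPGroup' h) R.isPGroup'
  rw [← normalizer_eq_top_iff]
  refine not_lt_top_iff.mp fun hlt ↦ ?_
  have hsup := R.normalizer_sup_eq_top' hRN
  rw [sup_comm] at hsup
  obtain ⟨P', hP'⟩ := exists_sylow_le_normalizer hsup (hprop N hN) (hprop _ hlt)
  exact hR R P' (Subgroup.le_normalizer.trans hP')

theorem PClosed.isNilpotent_of_sup_eq_top {q : ℕ} [Fact q.Prime] (hqp : q ≠ p)
    {R P H : Subgroup G} [R.Normal] (hR : IsPGroup q R) (hP : IsPGroup p P) (h : R ⊔ P = ⊤)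
    (hH : PClosed p H) : Group.IsNilpotent H := by
  refine (Group.isNilpotent_of_finite_tfae.out 0 3 rfl rfl).mpr fun r hr X ↦ ?_
  rcases eq_or_ne r p with rfl | hrp
  · exact hH.normal
  have hXR : (X : Subgroup H) ≤ R.subgroupOf H := map_le_iff_le_comap.mp <|
    le_of_isPGroup_quotient hrp (isPGroup_quotient_of_sup_eq_top hP h) (X.isPGroup'.map H.subtype)
  rcases eq_or_ne r q with rfl | hrq
  · rw [← X.is_maximal' hR.comap_subtype hXR]
    infer_instance
  · have hd := IsPGroup.disjoint_of_ne r q hrq X (R.subgroupOf H) X.isPGroup' hR.comap_subtype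
    rw [hd.eq_bot_of_le hXR]
    infer_instance

theorem PClosed.of_isNilpotent (h : Group.IsNilpotent G) : PClosed p G := by
  obtain ⟨P⟩ : Nonempty (Sylow p G) := inferInstance
  exact ⟨P, inferInstance⟩

theorem isNilpotent_of_commutator_le_frattini (h : _root_.commutator G ≤ frattini G) :
    Group.IsNilpotent G :=
  (Group.isNilpotent_of_finite_tfae.out 0 2 rfl rfl).mpr fun _ hM ↦
    .of_commutator_le _ (h.trans (frattini_le_coatom hM))

end

theorem exists_isCoatom_not_le {G : Type*} [Group G] {N : Subgroup G} (h : ¬N ≤ frattini G) :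
    ∃ M : Subgroup G, IsCoatom M ∧ ¬N ≤ M := by
  contrapose! h
  exact le_iInf₂ h

theorem stmt16 (p : ℕ) [Fact p.Prime] {G : Type*} [Group G] [Finite G]
    (hG : ¬PClosed p G)
    (hprop : ∀ H : Subgroup G, H < ⊤ → PClosed p H) :
    (¬Group.IsNilpotent G ∧ ∀ H : Subgroup G, H < ⊤ → Group.IsNilpotent H) ∨
      (IsSimpleGroup (G ⧸ frattini G) ∧ ∃ a b : G ⧸ frattini G, a * b ≠ b * a) := by
  have hnil : ¬Group.IsNilpotent G := fun h ↦ hG (.of_isNilpotent h)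
  have hcomm : ∃ a b : G ⧸ frattini G, a * b ≠ b * a := by
    by_contra! hc
    refine hnil (isNilpotent_of_commutator_le_frattini ?_)
    exact Normal.quotient_commutative_iff_commutator_le.mp ⟨⟨hc⟩⟩
  by_cases hs : ∀ K : Subgroup (G ⧸ frattini G), K.Normal → K = ⊥ ∨ K = ⊤
  · obtain ⟨a, b, hab⟩ := hcomm
    exact .inr ⟨{ exists_pair_ne := ⟨_, _, hab⟩, eq_bot_or_eq_top_of_normal := hs }, a, b, hab⟩
  left
  push Not at hs
  obtain ⟨K, hK, hbot, htop⟩ := hs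
  have hsurj := QuotientGroup.mk'_surjective (frattini G)
  have hNtop : K.comap (QuotientGroup.mk' (frattini G)) < ⊤ := by
    rw [lt_top_iff_ne_top, ← comap_top (QuotientGroup.mk' (frattini G))]
    exact fun h ↦ htop (comap_injective hsurj h)
  have hNle : ¬K.comap (QuotientGroup.mk' (frattini G)) ≤ frattini G := fun h ↦ hbot <| by
    rw [← map_comap_eq_self_of_surjective hsurj K, Subgroup.map_eq_bot_iff, QuotientGroup.ker_mk']
    exact h
  obtain ⟨M, hM, hNM⟩ := exists_isCoatom_not_le hNle
  have hsup : K.comap (QuotientGroup.mk' (frattini G)) ⊔ M = ⊤ :=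
    hM.2 _ (right_lt_sup.mpr hNM)
  obtain ⟨P, hP⟩ := exists_sup_sylow_eq_top hG hprop hNtop hM.lt_top hsup
  obtain ⟨q, hq, hqp, R, hR, hRP⟩ := exists_normal_sylow_sup_eq_top hG hprop hNtop hP
  have : Fact q.Prime := ⟨hq⟩
  exact ⟨hnil, fun H hH ↦
    (hprop H hH).isNilpotent_of_sup_eq_top hqp R.isPGroup' P.isPGroup' hRP⟩
end

section
/- Let G be a finite group, p a prime and S a Sylow p-subgroup of G, and suppose gcd(|G|, p−1) = 1. If there exists a chain 1 = S_0 ≤ S_1 ≤ … ≤ S_m = S of subgroups of S such that each S_i is strongly closed in S with respect to G and each successive quotient S_{i+1}/S_i is cyclic (i.e., F_S(G) is supersolvable), then G is p-nilpotent. -/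
/-- `T` is strongly closed in `S` with respect to `G`. -/
def StronglyClosed {G : Type*} [Group G] (S T : Subgroup G) : Prop :=
  T ≤ S ∧ ∀ x ∈ T, ∀ g : G, g⁻¹ * x * g ∈ S → g⁻¹ * x * g ∈ T

/-- The fusion system `F_S(G)` is supersolvable. -/
def FusionSupersolvable {G : Type*} [Group G] (S : Subgroup G) : Prop :=
  ∃ (m : ℕ) (c : Fin (m + 1) → Subgroup G), Monotone c ∧ c 0 = ⊥ ∧ c (Fin.last m) = S ∧
    (∀ i, StronglyClosed S (c i)) ∧ ∀ i : Fin m, CyclicFactor (c i.castSucc) (c i.succ)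

open Pointwise in
/-- `G` is `p`-nilpotent: it has a normal `p`-complement with respect to the
Sylow `p`-subgroup `S`. -/
def PNilpotent {G : Type*} [Group G] (S : Subgroup G) : Prop :=
  ∃ N : Subgroup G, N.Normal ∧ N ⊓ S = ⊥ ∧ (N : Set G) * (S : Set G) = Set.univ

section FusionHelpers

open Subgroup Pointwise commutatorElement

variable {G : Type*} [Group G] {p : ℕ}

theorem exists_coprime_orderOf_pow [Finite G] [Fact p.Prime] (g : G) :
    ∃ k : ℕ, p.Coprime (orderOf (g ^ p ^ k)) := by
  have hp : p.Prime := Fact.out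
  obtain ⟨k, m, hm, h⟩ := Nat.exists_eq_pow_mul_and_not_dvd (orderOf_pos g).ne' p hp.ne_one
  refine ⟨k, ?_⟩
  rw [orderOf_pow_of_dvd (pow_ne_zero _ hp.ne_zero) ⟨m, h⟩, h,
    Nat.mul_div_cancel_left _ (pow_pos hp.pos k)]
  exact (Nat.Prime.coprime_iff_not_dvd hp).2 hm

theorem IsPGroup.eq_one_of_coprime_of_pow_eq_one (hG : IsPGroup p G) {n : ℕ} (hn : p.Coprime n)
    {g : G} (hg : g ^ n = 1) : g = 1 := by
  have h := hG.orderOf_coprime hn g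
  exact orderOf_eq_one_iff.1 (Nat.Coprime.eq_one_of_dvd h (orderOf_dvd_of_pow_eq_one hg))

theorem isPGroup_quotient_of_coprime_orderOf_mem [Finite G] [Fact p.Prime] {N : Subgroup G}
    [N.Normal] (h : ∀ g : G, p.Coprime (orderOf g) → g ∈ N) : IsPGroup p (G ⧸ N) := by
  intro x
  obtain ⟨g, rfl⟩ := QuotientGroup.mk_surjective x
  obtain ⟨k, hk⟩ := exists_coprime_orderOf_pow (p := p) g
  exact ⟨k, (QuotientGroup.eq_one_iff _).2 (h _ hk)⟩

theorem Sylow.sup_eq_top_of_isPGroup_quotient [Finite G] [Fact p.Prime] (P : Sylow p G)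
    {N : Subgroup G} [N.Normal] (h : IsPGroup p (G ⧸ N)) : N ⊔ (P : Subgroup G) = ⊤ := by
  obtain ⟨n, hn⟩ := IsPGroup.iff_card.1 h
  have h1 : (N ⊔ (P : Subgroup G)).index ∣ p ^ n :=
    hn ▸ index_dvd_of_le (le_sup_left : N ≤ N ⊔ (P : Subgroup G))
  have h2 : (N ⊔ (P : Subgroup G)).index ∣ (P : Subgroup G).index := index_dvd_of_le le_sup_right
  have h3 : (p ^ n).Coprime (P : Subgroup G).index :=
    ((Nat.Prime.coprime_iff_not_dvd Fact.out).2 P.not_dvd_index).pow_left n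
  exact index_eq_one.1 (Nat.eq_one_of_dvd_coprimes h3 h1 h2)

/-- Every `p'`-element of the normalizer of a `p`-subgroup centralizes that subgroup. -/
def CoprimeNormalizersCentralize (p : ℕ) (G : Type*) [Group G] : Prop :=
  ∀ Q : Subgroup G, IsPGroup p Q → ∀ y ∈ normalizer (Q : Set G), p.Coprime (orderOf y) →
    y ∈ centralizer (Q : Set G)

theorem CoprimeNormalizersCentralize.subgroup [Finite G] (h : CoprimeNormalizersCentralize p G)
    (K : Subgroup G) : CoprimeNormalizersCentralize p K := by
  intro Q hQ y hy hc
  have hy' : (y : G) ∈ normalizer ((Q.map K.subtype : Subgroup G) : Set G) := by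
    apply mem_normalizer_fintype
    rintro _ ⟨x, hx, rfl⟩
    exact ⟨y * x * y⁻¹, (mem_normalizer_iff.1 hy x).1 hx, by simp⟩
  have := h _ (hQ.map K.subtype) y hy' (by simpa using hc)
  rw [mem_centralizer_iff] at this ⊢
  intro x hx
  exact Subtype.ext (this x ⟨x, hx, rfl⟩)

/-- If `p'`-elements of normalizers centralize, `N(D)` is the product of `C(D)` and any Sylow
`p`-subgroup of `N(D)`. -/
theorem CoprimeNormalizersCentralize.exists_mul_eq [Finite G] [Fact p.Prime]
    (h : CoprimeNormalizersCentralize p G) {D : Subgroup G} (hD : IsPGroup p D)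
    (U : Sylow p (normalizer (D : Set G))) (n : normalizer (D : Set G)) :
    ∃ c : normalizer (D : Set G), (c : G) ∈ centralizer (D : Set G) ∧ ∃ u ∈ U, c * u = n := by
  let C : Subgroup (normalizer (D : Set G)) := D.normalizerMonoidHom.ker
  have hC : ∀ c : normalizer (D : Set G), c ∈ C ↔ (c : G) ∈ centralizer (D : Set G) := by
    intro c
    simp only [C, normalizerMonoidHom_ker, mem_subgroupOf]
  have hq : IsPGroup p (normalizer (D : Set G) ⧸ C) :=
    isPGroup_quotient_of_coprime_orderOf_mem fun g hg ↦
      (hC g).2 (h D hD g g.2 (by simpa using hg))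
  have htop := U.sup_eq_top_of_isPGroup_quotient hq
  have hn : n ∈ C ⊔ (U : Subgroup _) := htop ▸ mem_top n
  obtain ⟨c, hc, u, hu, rfl⟩ := mem_sup_of_normal_left.1 hn
  exact ⟨c, (hC c).1 hc, u, hu, rfl⟩

theorem Sylow.lt_inf_normalizer [Finite G] [Fact p.Prime] (P : Sylow p G) {D : Subgroup G}
    (hD : D < P) : D < (P : Subgroup G) ⊓ normalizer (D : Set G) := by
  have hN : Group.IsNilpotent P := P.2.isNilpotent
  refine lt_of_le_of_ne (le_inf hD.le le_normalizer) fun heq ↦ ?_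
  have h1 : D.subgroupOf P < ⊤ := by
    rw [lt_top_iff_ne_top, Ne, subgroupOf_eq_top]
    exact hD.not_ge
  have h2 := Group.normalizerCondition_of_isNilpotent (D.subgroupOf P) h1
  obtain ⟨x, hx, hx'⟩ := SetLike.exists_of_lt h2
  apply hx'
  rw [mem_subgroupOf, heq]
  refine ⟨x.2, mem_normalizer_fintype fun d hd ↦ ?_⟩
  exact (mem_normalizer_iff.1 hx ⟨d, hD.le hd⟩).1 hd

/-- Two Sylow `p`-subgroups are conjugate by an element centralizing their intersection. -/
theorem CoprimeNormalizersCentralize.exists_smul_eq [Finite G] [Fact p.Prime]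
    (h : CoprimeNormalizersCentralize p G) (P Q : Sylow p G) :
    ∃ c ∈ centralizer (((P : Subgroup G) ⊓ Q : Subgroup G) : Set G), c • Q = P := by
  induction hn : Nat.card G - Nat.card ((P : Subgroup G) ⊓ Q : Subgroup G)
    using Nat.strong_induction_on generalizing P Q with
  | _ n ih =>
  subst hn
  set D : Subgroup G := (P : Subgroup G) ⊓ Q with hDdef
  have ih' : ∀ P' Q' : Sylow p G, D < (P' : Subgroup G) ⊓ Q' →
      ∃ c ∈ centralizer (D : Set G), c • Q' = P' := by
    intro P' Q' hlt
    have h1 : Nat.card D < Nat.card ((P' : Subgroup G) ⊓ Q' : Subgroup G) :=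
      Set.ncard_lt_ncard hlt (Set.toFinite _)
    have h2 := card_le_card_group ((P' : Subgroup G) ⊓ Q' : Subgroup G)
    obtain ⟨c, hc, e⟩ := ih _ (by omega) P' Q' rfl
    exact ⟨c, centralizer_le hlt.le hc, e⟩
  by_cases hPQ : (P : Subgroup G) ≤ Q
  · have : P = Q := Sylow.ext (P.3 Q.2 hPQ).symm
    exact ⟨1, one_mem _, by rw [one_smul, this]⟩
  have hQP : ¬ (Q : Subgroup G) ≤ P := fun hle ↦ hPQ (Q.3 P.2 hle).le
  have hDP : D < P := lt_of_le_of_ne inf_le_left fun e ↦ hPQ (e ▸ inf_le_right)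
  have hDQ : D < Q := lt_of_le_of_ne inf_le_right fun e ↦ hQP (e ▸ inf_le_left)
  have hDp : IsPGroup p D := P.2.to_le hDP.le
  obtain ⟨U, hU⟩ := IsPGroup.exists_le_sylow
    (P.2.comap_subtype (K := normalizer (D : Set G)))
  obtain ⟨V, hV⟩ := IsPGroup.exists_le_sylow
    (Q.2.comap_subtype (K := normalizer (D : Set G)))
  obtain ⟨m, hm⟩ := MulAction.exists_smul_eq (normalizer (D : Set G)) V U
  obtain ⟨c, hc, v, hv, rfl⟩ := h.exists_mul_eq hDp V m
  have hcV : c • V = U := by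
    rw [mul_smul, Sylow.smul_eq_iff_mem_normalizer.2 (le_normalizer hv)] at hm
    exact hm
  obtain ⟨R, hR⟩ := (U.2.map (normalizer (D : Set G)).subtype).exists_le_sylow
  have hPR : D < (P : Subgroup G) ⊓ R := by
    refine (P.lt_inf_normalizer hDP).trans_le (le_inf inf_le_left ?_)
    intro x hx
    exact hR ⟨⟨x, hx.2⟩, hU hx.1, rfl⟩
  obtain ⟨a, ha, haR⟩ := ih' P R hPR
  have hRQ : D < (R : Subgroup G) ⊓ ((c : G) • Q : Sylow p G) := by
    have hlt := Q.lt_inf_normalizer hDQ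
    obtain ⟨z, hz, hzD⟩ := SetLike.exists_of_lt hlt
    have key : ∀ x ∈ (Q : Subgroup G) ⊓ normalizer (D : Set G),
        (c : G) * x * (c : G)⁻¹ ∈ (R : Subgroup G) ⊓ ((c : G) • Q : Sylow p G) := by
      intro x hx
      constructor
      · refine hR ⟨c * ⟨x, hx.2⟩ * c⁻¹, ?_, rfl⟩
        rw [← hcV]
        have hxV : (⟨x, hx.2⟩ : normalizer (D : Set G)) ∈ V.toSubgroup := hV hx.1
        exact smul_mem_pointwise_smul _ (MulAut.conj c) V.toSubgroup hxV
      · exact smul_mem_pointwise_smul _ (MulAut.conj (c : G)) (Q : Subgroup G) hx.1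
    refine lt_of_le_of_ne ?_ fun e ↦ ?_
    · intro d hd
      have := key d (hlt.le hd)
      rwa [← mem_centralizer_iff.1 hc d hd, mul_inv_cancel_right] at this
    · have h1 := key z hz
      rw [← e] at h1
      exact hzD ((mem_normalizer_iff.1 c.2 z).2 h1)
  obtain ⟨b, hb, hbQ⟩ := ih' R _ hRQ
  exact ⟨a * b * c, mul_mem (mul_mem ha hb) hc, by rw [mul_smul, mul_smul, hbQ, haR]⟩

theorem CoprimeNormalizersCentralize.focalSubgroup_le [Finite G] [Fact p.Prime]
    (h : CoprimeNormalizersCentralize p G) (P : Sylow p G) :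
    (P : Subgroup G).focalSubgroup ≤ ⁅(P : Subgroup G), (P : Subgroup G)⁆ := by
  rw [focalSubgroup_def, closure_le]
  rintro _ ⟨hg, x, hx, u, rfl⟩
  have hux : u * x * u⁻¹ ∈ (P : Subgroup G) := by
    have := inv_mem (mul_mem (inv_mem hx) hg)
    simpa [commutatorElement_def, mul_assoc] using this
  have hx' : x ∈ ((u⁻¹ • P : Sylow p G) : Subgroup G) := by
    have := smul_mem_pointwise_smul _ (MulAut.conj u⁻¹) (P : Subgroup G) hux
    rwa [MulAut.smul_def, MulAut.conj_apply, inv_inv,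
      show u⁻¹ * (u * x * u⁻¹) * u = x by group] at this
  obtain ⟨c, hc, hcP⟩ := h.exists_smul_eq P (u⁻¹ • P)
  rw [smul_smul, Sylow.smul_eq_iff_mem_normalizer] at hcP
  have hcx := mem_centralizer_iff.1 hc x ⟨hx, hx'⟩
  obtain ⟨d, hd, s, hs, hds⟩ := h.exists_mul_eq P.2 (P.subtype le_normalizer) ⟨c * u⁻¹, hcP⟩
  have hds' : (d : G) * s = c * u⁻¹ := congrArg Subtype.val hds
  have hsP : (s : G) ∈ (P : Subgroup G) := hs
  have hdx := mem_centralizer_iff.1 hd _ hx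
  have e : u * x * u⁻¹ = (s : G)⁻¹ * x * s := by
    have hu : u = (s : G)⁻¹ * (d : G)⁻¹ * c := by
      rw [← mul_inv_rev, hds']; group
    have e1 : c * x * c⁻¹ = x := by rw [← hcx]; group
    have e2 : (d : G)⁻¹ * x * d = x := by rw [mul_assoc, hdx]; group
    calc u * x * u⁻¹ = (s : G)⁻¹ * ((d : G)⁻¹ * (c * x * c⁻¹) * d) * s := by rw [hu]; group
      _ = _ := by rw [e1, e2]
  have e' : ⁅x, u⁆ = ⁅x, (s : G)⁻¹⁆ := by
    have e3 : ∀ t : G, ⁅x, t⁆ = x * (t * x * t⁻¹)⁻¹ := by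
      intro t; rw [commutatorElement_def]; group
    rw [e3, e3, e, inv_inv]
  rw [e']
  exact commutator_mem_commutator hx (inv_mem hsP)

/-- **Frobenius' normal `p`-complement theorem**, in terms of `p'`-elements. -/
theorem CoprimeNormalizersCentralize.coprime_orderOf_mul (n : ℕ) [Fact p.Prime] :
    ∀ (G : Type*) [Group G] [Finite G], Nat.card G = n → CoprimeNormalizersCentralize p G →
      ∀ x y : G, p.Coprime (orderOf x) → p.Coprime (orderOf y) →
        p.Coprime (orderOf (x * y)) := by
  induction n using Nat.strong_induction_on with
  | _ n ih =>
  intro G _ _ hn h x y hx hy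
  let P : Sylow p G := default
  by_cases hP : (P : Subgroup G) = ⊥
  · have hnd := P.not_dvd_index
    rw [hP, index_bot] at hnd
    exact ((Nat.Prime.coprime_iff_not_dvd Fact.out).2 hnd).coprime_dvd_right
      (orderOf_dvd_natCard _)
  let K : Subgroup G := (P : Subgroup G).transferFocal.ker
  have hK : K ≠ ⊤ := by
    intro hK
    have h1 := ker_transferFocal_inf_eq_focalSubgroup P
    rw [show (P : Subgroup G).transferFocal.ker = ⊤ from hK, top_inf_eq] at h1
    have h2 : (P : Subgroup G) ≤ ⁅(P : Subgroup G), (P : Subgroup G)⁆ :=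
      h1.le.trans (h.focalSubgroup_le P)
    have hN : Group.IsNilpotent P := P.2.isNilpotent
    have hnt : Nontrivial (P : Subgroup G) := (nontrivial_iff_ne_bot _).2 hP
    refine (Group.IsSolvable.commutator_lt_top_of_nontrivial (P : Subgroup G)).not_ge ?_
    rw [← map_subtype_le_map_subtype, map_subtype_commutator, ← MonoidHom.range_eq_map,
      range_subtype]
    exact h2
  have hmem : ∀ g : G, p.Coprime (orderOf g) → g ∈ K := by
    intro g hg
    refine IsPGroup.eq_one_of_coprime_of_pow_eq_one (P.2.to_quotient _) hg ?_
    rw [← map_pow, pow_orderOf_eq_one, map_one]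
  have hlt : Nat.card K < n := by
    rw [← hn]
    exact lt_of_le_of_ne (card_le_card_group K) fun e ↦ hK (eq_top_of_card_eq K e)
  have := ih _ hlt K rfl (h.subgroup K) ⟨x, hmem x hx⟩ ⟨y, hmem y hy⟩
    (by simpa using hx) (by simpa using hy)
  simpa [← orderOf_coe] using this

theorem CoprimeNormalizersCentralize.pNilpotent [Finite G] [Fact p.Prime]
    (h : CoprimeNormalizersCentralize p G) (S : Sylow p G) : PNilpotent (S : Subgroup G) := by
  let N : Subgroup G :=
    { carrier := {g | p.Coprime (orderOf g)}
      one_mem' := by simp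
      mul_mem' := fun {x y} hx hy ↦ coprime_orderOf_mul _ G rfl h x y hx hy
      inv_mem' := fun {x} hx ↦ by simpa using hx }
  have hN : N.Normal := ⟨fun x (hx : p.Coprime (orderOf x)) g ↦ by
    have : orderOf (g * x * g⁻¹) = orderOf x := (MulAut.conj g).orderOf_eq x
    change p.Coprime (orderOf (g * x * g⁻¹))
    rwa [this]⟩
  refine ⟨N, hN, ?_, ?_⟩
  · rw [eq_bot_iff]
    rintro x ⟨hx : p.Coprime (orderOf x), hxS⟩
    have := S.2.eq_one_of_coprime_of_pow_eq_one hx (g := ⟨x, hxS⟩)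
      (Subtype.ext (by simp [pow_orderOf_eq_one]))
    exact congrArg Subtype.val this
  · have := S.sup_eq_top_of_isPGroup_quotient
      (isPGroup_quotient_of_coprime_orderOf_mem (N := N) fun g hg ↦ hg)
    rw [← normal_mul, this, coe_top]

theorem MulAut.eq_one_of_isCyclic_of_coprime [Finite G] [Fact p.Prime] (hG : IsPGroup p G)
    [hc : IsCyclic G] {n : ℕ} (hn : p.Coprime n) (hn' : (p - 1).Coprime n) {f : MulAut G}
    (hf : f ^ n = 1) : f = 1 := by
  obtain ⟨k, hk⟩ := IsPGroup.iff_card.1 hG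
  have h1 : orderOf f ∣ n := orderOf_dvd_of_pow_eq_one hf
  have h2 : orderOf f ∣ Nat.card (MulAut G) := orderOf_dvd_natCard f
  rw [hc.card_mulAut, hk] at h2
  have h3 : (Nat.totient (p ^ k)).Coprime n := by
    rcases Nat.eq_zero_or_pos k with rfl | h0
    · simp
    · rw [Nat.totient_prime_pow Fact.out h0]
      exact (hn.pow_left _).mul_left hn'
  exact orderOf_eq_one_iff.1 (Nat.eq_one_of_dvd_coprimes h3 h2 h1)

theorem MulAut.eq_one_of_fixes_ker_of_coprime {C : Type*} [Group C] [IsCyclic C] [Finite G]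
    [Fact p.Prime] (hG : IsPGroup p G) (π : G →* C) {n : ℕ} (hn : p.Coprime n)
    (hn' : (p - 1).Coprime n) {f : MulAut G} (hf : f ^ n = 1) (hker : ∀ x ∈ π.ker, f x = x) :
    f = 1 := by
  have : IsCyclic (G ⧸ π.ker) := isCyclic_of_injective _ (QuotientGroup.kerLift_injective π)
  have hmap : π.ker.map (f : G →* G) = π.ker := by
    ext x
    constructor
    · rintro ⟨y, hy, rfl⟩
      have : f y = y := hker y hy
      simpa [this] using hy
    · exact fun hx ↦ ⟨x, hx, hker x hx⟩
  let F : MulAut (G ⧸ π.ker) := QuotientGroup.congr _ _ f hmap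
  have hF : ∀ (j : ℕ) (x : G), (F ^ j) (x : G ⧸ π.ker) = ((f ^ j) x : G) := by
    intro j
    induction j with
    | zero => intro x; rfl
    | succ j ih => intro x; rw [pow_succ, pow_succ, MulAut.mul_apply, MulAut.mul_apply, ← ih]; rfl
  have hF1 : F = 1 := by
    refine MulAut.eq_one_of_isCyclic_of_coprime (hG.to_quotient _) hn hn' ?_
    ext x
    obtain ⟨x, rfl⟩ := QuotientGroup.mk_surjective x
    rw [hF, hf]
    rfl
  ext x
  have hx : (f x : G ⧸ π.ker) = x := by
    have := hF 1 x
    rwa [hF1, one_pow, pow_one, MulAut.one_apply, eq_comm] at this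
  have ha : x⁻¹ * f x ∈ π.ker := QuotientGroup.eq.1 hx.symm
  have hj : ∀ j : ℕ, (f ^ j) x = x * (x⁻¹ * f x) ^ j := by
    intro j
    induction j with
    | zero => simp
    | succ j ih =>
      rw [pow_succ', MulAut.mul_apply, ih, map_mul, map_pow, hker _ ha, pow_succ', ← mul_assoc,
        ← mul_assoc, mul_inv_cancel, one_mul]
  have hpow : (x⁻¹ * f x) ^ n = 1 := by
    have := hj n
    rw [hf, MulAut.one_apply] at this
    exact left_eq_mul.1 this
  have := hG.eq_one_of_coprime_of_pow_eq_one hn hpow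
  rw [MulAut.one_apply]
  exact (inv_mul_eq_one.1 this).symm

theorem StronglyClosed.normal_subgroupOf {S A B : Subgroup G} (hA : StronglyClosed S A)
    (hBS : B ≤ S) : (A.subgroupOf B).Normal := by
  refine ⟨fun a ha b ↦ ?_⟩
  have hbS := hBS b.2
  have := hA.2 a ha (b : G)⁻¹
    (by simpa using mul_mem (mul_mem hbS (hA.1 ha)) (inv_mem hbS))
  simpa [mem_subgroupOf] using this

theorem CyclicFactor.isCyclic_quotient {A B : Subgroup G} [(A.subgroupOf B).Normal]
    (h : CyclicFactor A B) : IsCyclic (B ⧸ A.subgroupOf B) := by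
  obtain ⟨x, hx, hxy⟩ := h
  refine ⟨⟨((⟨x, hx⟩ : B) : B ⧸ A.subgroupOf B), fun z ↦ ?_⟩⟩
  obtain ⟨y, rfl⟩ := QuotientGroup.mk_surjective z
  obtain ⟨n, hn⟩ := hxy y y.2
  refine ⟨n, ?_⟩
  change (((⟨x, hx⟩ : B) ^ n : B) : B ⧸ A.subgroupOf B) = y
  exact (QuotientGroup.eq.2 (by simpa [mem_subgroupOf] using hn)).symm

theorem StronglyClosed.mem_centralizer_inf [Finite G] [Fact p.Prime] {S A B Q : Subgroup G}
    (hA : StronglyClosed S A) (hB : StronglyClosed S B) (hc : CyclicFactor A B)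
    (hQ : IsPGroup p Q) (hQS : Q ≤ S) {y : G} (hy : y ∈ normalizer (Q : Set G))
    (hn : p.Coprime (orderOf y)) (hn' : (p - 1).Coprime (orderOf y))
    (hyA : y ∈ centralizer ((Q ⊓ A : Subgroup G) : Set G)) :
    y ∈ centralizer ((Q ⊓ B : Subgroup G) : Set G) := by
  have hyB : y ∈ normalizer ((Q ⊓ B : Subgroup G) : Set G) := by
    apply mem_normalizer_fintype
    rintro x ⟨hxQ, hxB⟩
    have h1 := (mem_normalizer_iff.1 hy x).1 hxQ
    have h2 := hB.2 x hxB y⁻¹ (by simpa using hQS h1)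
    exact ⟨h1, by simpa using h2⟩
  have := hA.normal_subgroupOf hB.1
  have := hc.isCyclic_quotient
  let π : (Q ⊓ B : Subgroup G) →* B ⧸ A.subgroupOf B :=
    (QuotientGroup.mk' _).comp (inclusion inf_le_right)
  let Y : normalizer ((Q ⊓ B : Subgroup G) : Set G) := ⟨y, hyB⟩
  have hY : (Q ⊓ B).normalizerMonoidHom Y = 1 := by
    refine MulAut.eq_one_of_fixes_ker_of_coprime hQ.to_inf_left π hn hn' ?_ ?_
    · rw [← map_pow, show Y ^ orderOf y = 1 from Subtype.ext (pow_orderOf_eq_one y), map_one]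
    · intro x hx
      have hxA : (x : G) ∈ A := by
        have : inclusion inf_le_right x ∈ A.subgroupOf B := (QuotientGroup.eq_one_iff _).1 hx
        exact this
      refine Subtype.ext ?_
      change y * (x : G) * y⁻¹ = x
      rw [← mem_centralizer_iff.1 hyA x ⟨x.2.1, hxA⟩, mul_inv_cancel_right]
  have hY' := MonoidHom.mem_ker.2 hY
  rwa [normalizerMonoidHom_ker] at hY'

theorem FusionSupersolvable.coprimeNormalizersCentralize [Finite G] [Fact p.Prime]
    (S : Sylow p G) (hgcd : Nat.gcd (Nat.card G) (p - 1) = 1)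
    (h : FusionSupersolvable (S : Subgroup G)) : CoprimeNormalizersCentralize p G := by
  obtain ⟨m, c, -, h0, hm, hsc, hcyc⟩ := h
  have main : ∀ Q : Subgroup G, IsPGroup p Q → Q ≤ S → ∀ y ∈ normalizer (Q : Set G),
      p.Coprime (orderOf y) → y ∈ centralizer (Q : Set G) := by
    intro Q hQ hQS y hy hn
    have hn' : (p - 1).Coprime (orderOf y) :=
      (Nat.Coprime.symm hgcd).coprime_dvd_right (orderOf_dvd_natCard y)
    have hi : ∀ i : Fin (m + 1), y ∈ centralizer ((Q ⊓ c i : Subgroup G) : Set G) := by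
      intro i
      induction i using Fin.induction with
      | zero => rw [h0, inf_bot_eq, mem_centralizer_iff]; rintro x rfl; simp
      | succ i ih =>
        exact (hsc _).mem_centralizer_inf (hsc _) (hcyc i) hQ hQS hy
          hn hn' ih
    have := hi (Fin.last m)
    rwa [hm, inf_eq_left.2 hQS] at this
  intro Q hQ y hy hn
  obtain ⟨R, hR⟩ := hQ.exists_le_sylow
  obtain ⟨g, rfl⟩ := MulAction.exists_smul_eq G R S
  have key := main (Q.map (MulAut.conj g).toMonoidHom) (hQ.map _) (map_mono hR)
    (g * y * g⁻¹) ?_ ?_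
  · rw [mem_centralizer_iff] at key ⊢
    intro x hx
    exact (MulAut.conj g).injective (by simpa using key _ ⟨x, hx, rfl⟩)
  · apply mem_normalizer_fintype
    rintro _ ⟨x, hx, rfl⟩
    exact ⟨y * x * y⁻¹, (mem_normalizer_iff.1 hy x).1 hx, by simp [mul_assoc]⟩
  · have : orderOf (g * y * g⁻¹) = orderOf y := (MulAut.conj g).orderOf_eq y
    rwa [this]

end FusionHelpers

theorem stmt18 {G : Type*} [Group G] [Finite G] (p : ℕ) [Fact p.Prime]
    (S : Sylow p G) (hgcd : Nat.gcd (Nat.card G) (p - 1) = 1)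
    (h : FusionSupersolvable (S : Subgroup G)) :
    PNilpotent (S : Subgroup G) :=
  (h.coprimeNormalizersCentralize S hgcd).pNilpotent S
end
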